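/- arXiv:1705.01219 — 2 statements merged into one kernel-verified Lean document; each statement's English description precedes it below -/
import Mathlib

section
/- Let k > 0 and a < 0 be real numbers. Define Φ_a : ℝ² → ℂ by Φ_a(z₁, z₂) = exp(i k √(z₁² + z₂² + a²)) / (4π √(z₁² + z₂² + a²)), and define I₁ : ℝ² → ℂ (for v₁² + v₂² ≠ k²) by I₁(v₁, v₂) = i · exp(−i a √(k² − v₁² − v₂²)) / (2 √(k² − v₁² − v₂²)) if v₁² + v₂² < k², and I₁(v₁, v₂) = exp(a √(v₁² + v₂² − k²)) / (2 √(v₁² + v₂² − k²)) if v₁² + v₂² > k². Then for every Schwartz function ψ : ℝ² → ℂ, the functions (z₁,z₂) ↦ Φ_a(z₁,z₂) · Ψ(z₁,z₂) and (v₁,v₂) ↦ I₁(v₁,v₂) · ψ(v₁,v₂) are integrable on ℝ², and ∫_{ℝ²} Φ_a(z₁,z₂) Ψ(z₁,z₂) dz₁ dz₂ = ∫_{ℝ²} I₁(v₁,v₂) ψ(v₁,v₂) dv₁ dv₂. (This says that the tempered-distribution Fourier transform on ℝ² of the slice of the outgoing fundamental solution of the Helmholtz equation equals I₁.) -/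
open MeasureTheory

/-- The restriction to the plane `{x₃ = a}` of the outgoing fundamental solution
`Φ_k(x) = exp(ik|x|)/(4π|x|)` of the 3D Helmholtz equation. -/
noncomputable def PhiSlice (k a : ℝ) (z : ℝ × ℝ) : ℂ :=
  Complex.exp (Complex.I * (k : ℂ) * (Real.sqrt (z.1 ^ 2 + z.2 ^ 2 + a ^ 2) : ℂ)) /
    (4 * (Real.pi : ℂ) * (Real.sqrt (z.1 ^ 2 + z.2 ^ 2 + a ^ 2) : ℂ))

/-- The claimed Fourier transform `I₁` of `PhiSlice`. -/
noncomputable def I1 (k a : ℝ) (v : ℝ × ℝ) : ℂ :=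
  if v.1 ^ 2 + v.2 ^ 2 < k ^ 2 then
    Complex.I * Complex.exp (-Complex.I * (a : ℂ) * (Real.sqrt (k ^ 2 - v.1 ^ 2 - v.2 ^ 2) : ℂ)) /
      (2 * (Real.sqrt (k ^ 2 - v.1 ^ 2 - v.2 ^ 2) : ℂ))
  else
    Complex.exp ((a : ℂ) * (Real.sqrt (v.1 ^ 2 + v.2 ^ 2 - k ^ 2) : ℂ)) /
      (2 * (Real.sqrt (v.1 ^ 2 + v.2 ^ 2 - k ^ 2) : ℂ))

/-- `Ψ(x) = ∫ ψ(v) e^{-i x·v} dv`, the (kernel `e^{-ix·v}`) Fourier transform of the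
Schwartz function `ψ`. -/
noncomputable def BigPsi (ψ : SchwartzMap (ℝ × ℝ) ℂ) (x : ℝ × ℝ) : ℂ :=
  ∫ v : ℝ × ℝ, ψ v * Complex.exp (-Complex.I * ((x.1 * v.1 + x.2 * v.2 : ℝ) : ℂ))


section Subordination
open Set Filter Topology

lemma ftc_Ioi_zero {f f' : ℝ → ℝ} {m l : ℝ} (h0 : Tendsto f (𝓝[>] 0) (𝓝 m))
    (hd : ∀ x ∈ Ioi (0:ℝ), HasDerivAt f (f' x) x) (hl : Tendsto f atTop (𝓝 l)) :
    ((∀ x ∈ Ioi (0:ℝ), 0 ≤ f' x) → IntegrableOn f' (Ioi 0)) ∧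
    (IntegrableOn f' (Ioi 0) → ∫ x in Ioi (0:ℝ), f' x = l - m) := by
  classical
  set g := Function.update f 0 m with hg
  have hgc : ContinuousWithinAt g (Ici 0) 0 := by
    rw [hg, continuousWithinAt_update_same]
    simpa using h0
  have hgd : ∀ x ∈ Ioi (0:ℝ), HasDerivAt g (f' x) x := by
    intro x hx
    refine (hd x hx).congr_of_eventuallyEq ?_
    filter_upwards [isOpen_ne.mem_nhds (ne_of_gt hx : x ≠ 0)] with y hy
    simp [hg, Function.update_of_ne hy]
  have hgl : Tendsto g atTop (𝓝 l) := by
    refine hl.congr' ?_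
    filter_upwards [eventually_gt_atTop 0] with y hy
    simp [hg, Function.update_of_ne hy.ne']
  refine ⟨fun h => integrableOn_Ioi_deriv_of_nonneg hgc hgd h hgl, fun h => ?_⟩
  rw [integral_Ioi_of_hasDerivAt_of_tendsto hgc hgd h hgl]
  simp [hg]

noncomputable def gErf (v : ℝ) : ℝ := ∫ x in (0:ℝ)..v, Real.exp (-x ^ 2)

lemma gErf_deriv (v : ℝ) : HasDerivAt gErf (Real.exp (-v ^ 2)) v := by
  have hc : Continuous fun x : ℝ => Real.exp (-x ^ 2) := by fun_prop
  exact intervalIntegral.integral_hasDerivAt_right (hc.intervalIntegrable _ _)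
    (hc.stronglyMeasurableAtFilter _ _) hc.continuousAt

lemma gErf_neg (v : ℝ) : gErf (-v) = - gErf v := by
  unfold gErf
  have := intervalIntegral.integral_comp_neg (a := 0) (b := v) (fun x : ℝ => Real.exp (-x ^ 2))
  simp only [neg_sq, neg_zero] at this
  rw [this, intervalIntegral.integral_symm]

lemma gErf_atTop : Tendsto gErf atTop (𝓝 (√Real.pi / 2)) := by
  have h := integral_gaussian_Ioi 1
  simp only [neg_mul, one_mul, div_one] at h
  rw [← h]
  refine intervalIntegral_tendsto_integral_Ioi 0 ?_ tendsto_id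
  have := (integrable_exp_neg_mul_sq (b := 1) one_pos).integrableOn (s := Ioi 0)
  simpa using this

lemma gErf_atBot : Tendsto gErf atBot (𝓝 (-(√Real.pi / 2))) := by
  have := (gErf_atTop.comp tendsto_neg_atBot_atTop).neg
  refine this.congr fun x => ?_
  simp [gErf_neg]

lemma subord (c μ : ℝ) (hc : 0 < c) (hμ : 0 < μ) :
    (IntegrableOn (fun s : ℝ => Real.exp (-(c ^ 2 / (4 * s ^ 2)) - μ ^ 2 * s ^ 2)) (Ioi 0) ∧
    ∫ s in Ioi (0:ℝ), Real.exp (-(c ^ 2 / (4 * s ^ 2)) - μ ^ 2 * s ^ 2)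
      = Real.exp (-(c * μ)) * √Real.pi / (2 * μ)) ∧
    (IntegrableOn (fun s : ℝ => Real.exp (-(c ^ 2 / (4 * s ^ 2)) - μ ^ 2 * s ^ 2) / s ^ 2) (Ioi 0) ∧
    ∫ s in Ioi (0:ℝ), Real.exp (-(c ^ 2 / (4 * s ^ 2)) - μ ^ 2 * s ^ 2) / s ^ 2
      = Real.exp (-(c * μ)) * √Real.pi / c) := by
  set P : ℝ → ℝ := fun s => Real.exp (-(μ * s - c / 2 * s⁻¹) ^ 2) * (μ - c / 2 * (-(s ^ 2)⁻¹)) with hP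
  set Q : ℝ → ℝ := fun s => Real.exp (-(μ * s + c / 2 * s⁻¹) ^ 2) * (μ + c / 2 * (-(s ^ 2)⁻¹)) with hQ
  have hPd : ∀ s ∈ Ioi (0:ℝ), HasDerivAt (fun s => gErf (μ * s - c / 2 * s⁻¹)) (P s) s := by
    intro s hs
    have h1 : HasDerivAt (fun s => μ * s - c / 2 * s⁻¹) (μ - c / 2 * (-(s ^ 2)⁻¹)) s := by
      have := ((hasDerivAt_id s).const_mul μ).sub ((hasDerivAt_inv (ne_of_gt hs)).const_mul (c/2))
      rw [mul_one] at this
      exact this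
    exact (gErf_deriv _).comp s h1
  have hQd : ∀ s ∈ Ioi (0:ℝ), HasDerivAt (fun s => gErf (μ * s + c / 2 * s⁻¹)) (Q s) s := by
    intro s hs
    have h1 : HasDerivAt (fun s => μ * s + c / 2 * s⁻¹) (μ + c / 2 * (-(s ^ 2)⁻¹)) s := by
      have := ((hasDerivAt_id s).const_mul μ).add ((hasDerivAt_inv (ne_of_gt hs)).const_mul (c/2))
      rw [mul_one] at this
      exact this
    exact (gErf_deriv _).comp s h1
  have t0 : Tendsto (fun s : ℝ => μ * s) (𝓝[>] 0) (𝓝 0) := by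
    have : Tendsto (fun s : ℝ => μ * s) (𝓝 0) (𝓝 (μ * 0)) := (continuous_const.mul continuous_id).tendsto 0
    rw [mul_zero] at this
    exact this.mono_left nhdsWithin_le_nhds
  have t0' : Tendsto (fun s : ℝ => c / 2 * s⁻¹) (𝓝[>] 0) atTop :=
    tendsto_inv_nhdsGT_zero.const_mul_atTop (by positivity)
  have t1 : Tendsto (fun s : ℝ => μ * s) atTop atTop := tendsto_id.const_mul_atTop hμ
  have t1' : Tendsto (fun s : ℝ => c / 2 * s⁻¹) atTop (𝓝 0) := by
    simpa using tendsto_inv_atTop_zero.const_mul (c/2)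
  have hPf := ftc_Ioi_zero
    (gErf_atBot.comp (by simpa [sub_eq_add_neg] using t0.add_atBot (tendsto_neg_atTop_atBot.comp t0'))) hPd
    (gErf_atTop.comp (by simpa [sub_eq_add_neg] using t1.atTop_add t1'.neg))
  have hQf := ftc_Ioi_zero
    (gErf_atTop.comp (t0.add_atTop t0')) hQd
    (gErf_atTop.comp (t1.atTop_add t1'))
  have hPi : IntegrableOn P (Ioi 0) := hPf.1 fun s hs => by
    have : 0 < s := hs
    simp only [hP]
    have : 0 ≤ c / 2 * (s^2)⁻¹ := by positivity
    exact mul_nonneg (Real.exp_pos _).le (by linarith)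
  have hPI := hPf.2 hPi
  have key1 : ∀ s ∈ Ioi (0:ℝ), Real.exp (-(c ^ 2 / (4 * s ^ 2)) - μ ^ 2 * s ^ 2) =
      Real.exp (-(c * μ)) * Real.exp (-(μ * s - c / 2 * s⁻¹) ^ 2) := by
    intro s hs
    have : s ≠ 0 := ne_of_gt hs
    rw [← Real.exp_add]; congr 1; field_simp; ring
  have key2 : ∀ s ∈ Ioi (0:ℝ), Real.exp (-(c ^ 2 / (4 * s ^ 2)) - μ ^ 2 * s ^ 2) =
      Real.exp (c * μ) * Real.exp (-(μ * s + c / 2 * s⁻¹) ^ 2) := by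
    intro s hs
    have : s ≠ 0 := ne_of_gt hs
    rw [← Real.exp_add]; congr 1; field_simp; ring
  have hQi : IntegrableOn Q (Ioi 0) := by
    refine (hPi.const_mul (Real.exp (-(2 * (c * μ))))).mono' (by fun_prop) ?_
    refine (ae_restrict_iff' measurableSet_Ioi).2 (ae_of_all _ fun s hs => ?_)
    have h1 := (key1 s hs).symm.trans (key2 s hs)
    have h2 : Real.exp (-(μ * s + c / 2 * s⁻¹) ^ 2) =
        Real.exp (-(2 * (c * μ))) * Real.exp (-(μ * s - c / 2 * s⁻¹) ^ 2) := by
      have : s ≠ 0 := ne_of_gt hs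
      rw [← Real.exp_add]; congr 1; field_simp; ring
    have : 0 < s := hs
    have h3 : 0 ≤ c / 2 * (s^2)⁻¹ := by positivity
    simp only [hQ, hP, norm_mul, Real.norm_eq_abs, Real.abs_exp]
    rw [h2, mul_assoc]
    gcongr
    rw [abs_le]; constructor <;> linarith
  have hQI := hQf.2 hQi
  have e1 : ∀ s ∈ Ioi (0:ℝ), (2 * μ)⁻¹ * (Real.exp (-(c * μ)) * P s + Real.exp (c * μ) * Q s) =
      Real.exp (-(c ^ 2 / (4 * s ^ 2)) - μ ^ 2 * s ^ 2) := by
    intro s hs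
    simp only [hP, hQ]
    rw [← mul_assoc, ← mul_assoc, ← key1 s hs, ← key2 s hs]
    field_simp; ring
  have e2 : ∀ s ∈ Ioi (0:ℝ), c⁻¹ * (Real.exp (-(c * μ)) * P s - Real.exp (c * μ) * Q s) =
      Real.exp (-(c ^ 2 / (4 * s ^ 2)) - μ ^ 2 * s ^ 2) / s ^ 2 := by
    intro s hs
    have : s ≠ 0 := ne_of_gt hs
    simp only [hP, hQ]
    rw [← mul_assoc, ← mul_assoc, ← key1 s hs, ← key2 s hs]
    field_simp; ring
  have i1 := ((hPi.const_mul (Real.exp (-(c * μ)))).add (hQi.const_mul (Real.exp (c * μ)))).const_mul (2*μ)⁻¹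
  have i2 := ((hPi.const_mul (Real.exp (-(c * μ)))).sub (hQi.const_mul (Real.exp (c * μ)))).const_mul c⁻¹
  refine ⟨⟨IntegrableOn.congr_fun i1 e1 measurableSet_Ioi, ?_⟩,
    IntegrableOn.congr_fun i2 e2 measurableSet_Ioi, ?_⟩
  · rw [← setIntegral_congr_fun measurableSet_Ioi e1, integral_const_mul, integral_add
      (hPi.const_mul _) (hQi.const_mul _), integral_const_mul, integral_const_mul, hPI, hQI]
    field_simp; ring
  · rw [← setIntegral_congr_fun measurableSet_Ioi e2, integral_const_mul, integral_sub
      (hPi.const_mul _) (hQi.const_mul _), integral_const_mul, integral_const_mul, hPI, hQI]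
    field_simp; ring

end Subordination
section Yukawa
open Set Filter Topology

lemma fubini_kernel {N : ℝ × ℝ → ℝ} {K : ℝ × ℝ → ℝ → ℝ} {M : ℝ} {h : ℝ × ℝ → ℂ}
    (hK : Measurable (Function.uncurry K)) (hK0 : ∀ x s, 0 ≤ K x s)
    (hKi : ∀ x, IntegrableOn (K x) (Ioi 0)) (hN : ∀ x, ∫ s in Ioi (0:ℝ), K x s = N x)
    (hM : ∀ x, N x ≤ M) (hh : Integrable h) :
    ∫ x, (N x : ℂ) * h x = ∫ s in Ioi (0:ℝ), ∫ x, (K x s : ℂ) * h x := by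
  have hN0 : ∀ x, 0 ≤ N x := fun x => by rw [← hN]; exact integral_nonneg (hK0 x)
  have hNm : AEStronglyMeasurable N volume := by
    have : N = fun x => ∫ s in Ioi (0:ℝ), K x s := by ext x; rw [hN]
    rw [this]
    exact (hK.stronglyMeasurable.integral_prod_right).aestronglyMeasurable
  rw [← integral_integral_swap]
  · congr 1; ext x
    rw [integral_mul_const, integral_complex_ofReal, hN]
  · rw [integrable_prod_iff]
    · constructor
      · refine ae_of_all _ fun x => ?_
        exact ((hKi x).ofReal (𝕜 := ℂ)).mul_const (h x)
      · have : (fun x => ∫ s in Ioi (0:ℝ), ‖Function.uncurry (fun x s => (K x s : ℂ) * h x) (x, s)‖)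
            = fun x => N x * ‖h x‖ := by
          ext x
          simp only [Function.uncurry, norm_mul, Complex.norm_real, Real.norm_eq_abs,
            abs_of_nonneg (hK0 _ _)]
          rw [integral_mul_const, hN]
        rw [this]
        refine hh.norm.bdd_mul (c := M) hNm (ae_of_all _ fun x => ?_)
        rw [Real.norm_of_nonneg (hN0 x)]; exact hM x
    · have h1 : AEStronglyMeasurable (fun p : (ℝ × ℝ) × ℝ => (K p.1 p.2 : ℂ))
          (volume.prod (volume.restrict (Ioi 0))) :=
        (Complex.measurable_ofReal.comp hK).aestronglyMeasurable
      exact h1.mul hh.aestronglyMeasurable.comp_fst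

lemma gauss1 (s : ℝ) (hs : 0 < s) (t : ℝ) :
    ∫ x : ℝ, Complex.exp (-((1 / (4 * s ^ 2) : ℝ) : ℂ) * (x:ℂ) ^ 2) * Complex.exp (-Complex.I * (x * t : ℝ)) =
      (2 * √Real.pi * s : ℝ) * (Real.exp (- s ^ 2 * t ^ 2) : ℝ) := by
  have h := fourierIntegral_gaussian (b := ((1 / (4 * s ^ 2) : ℝ) : ℂ))
    (by rw [Complex.ofReal_re]; positivity) (-t)
  have e : ∀ x : ℝ, Complex.exp (-((1 / (4 * s ^ 2) : ℝ) : ℂ) * (x:ℂ) ^ 2) * Complex.exp (-Complex.I * (x * t : ℝ))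
     = Complex.exp (Complex.I * (-t) * x) * Complex.exp (-((1 / (4 * s ^ 2) : ℝ) : ℂ) * (x:ℂ) ^ 2) := by
    intro x
    rw [mul_comm]; congr 2; push_cast; ring
  simp_rw [e]
  rw [h]
  congr 1
  · have : (Real.pi : ℂ) / ((1 / (4 * s ^ 2) : ℝ) : ℂ) = ((Real.pi * (2 * s) ^ 2 : ℝ) : ℂ) := by
      push_cast; field_simp; ring
    rw [this, show (1 / 2 : ℂ) = ((1 / 2 : ℝ) : ℂ) by push_cast; rfl, ← Complex.ofReal_cpow (by positivity),
      ← Real.sqrt_eq_rpow, Real.sqrt_mul Real.pi_pos.le, Real.sqrt_sq (by positivity)]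
    push_cast; ring
  · rw [Complex.ofReal_exp]
    congr 1
    have : (s:ℂ) ≠ 0 := by exact_mod_cast hs.ne'
    push_cast; field_simp

lemma gauss2 (s : ℝ) (hs : 0 < s) (v : ℝ × ℝ) :
    ∫ z : ℝ × ℝ, (Real.exp (-((z.1 ^ 2 + z.2 ^ 2) / (4 * s ^ 2))) : ℂ) *
        Complex.exp (-Complex.I * ((z.1 * v.1 + z.2 * v.2 : ℝ) : ℂ)) =
      (4 * Real.pi * s ^ 2 * Real.exp (- (s ^ 2 * (v.1 ^ 2 + v.2 ^ 2))) : ℝ) := by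
  have e : ∀ z : ℝ × ℝ, (Real.exp (-((z.1 ^ 2 + z.2 ^ 2) / (4 * s ^ 2))) : ℂ) *
        Complex.exp (-Complex.I * ((z.1 * v.1 + z.2 * v.2 : ℝ) : ℂ)) =
      (Complex.exp (-((1 / (4 * s ^ 2) : ℝ) : ℂ) * (z.1:ℂ) ^ 2) * Complex.exp (-Complex.I * (z.1 * v.1 : ℝ))) *
      (Complex.exp (-((1 / (4 * s ^ 2) : ℝ) : ℂ) * (z.2:ℂ) ^ 2) * Complex.exp (-Complex.I * (z.2 * v.2 : ℝ))) := by
    intro z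
    rw [Complex.ofReal_exp]
    simp only [← Complex.exp_add]
    congr 1
    push_cast; ring
  simp_rw [e]
  rw [Measure.volume_eq_prod, integral_prod_mul (f := fun x : ℝ => Complex.exp (-((1 / (4 * s ^ 2) : ℝ) : ℂ) * (x:ℂ) ^ 2) * Complex.exp (-Complex.I * (x * v.1 : ℝ)))
    (g := fun x : ℝ => Complex.exp (-((1 / (4 * s ^ 2) : ℝ) : ℂ) * (x:ℂ) ^ 2) * Complex.exp (-Complex.I * (x * v.2 : ℝ))),
    gauss1 s hs, gauss1 s hs, ← Complex.ofReal_mul, ← Complex.ofReal_mul, ← Complex.ofReal_mul]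
  congr 1
  have : √Real.pi * √Real.pi = Real.pi := Real.mul_self_sqrt Real.pi_pos.le
  have h2 : Real.exp (- (s ^ 2 * (v.1 ^ 2 + v.2 ^ 2))) = Real.exp (- s ^ 2 * v.1 ^ 2) * Real.exp (- s ^ 2 * v.2 ^ 2) := by
    rw [← Real.exp_add]; congr 1; ring
  rw [h2]
  linear_combination (4 * s ^ 2 * Real.exp (- s ^ 2 * v.1 ^ 2) * Real.exp (- s ^ 2 * v.2 ^ 2)) * this

lemma gauss_integrable2 (s : ℝ) (hs : 0 < s) :
    Integrable fun z : ℝ × ℝ => Real.exp (-((z.1 ^ 2 + z.2 ^ 2) / (4 * s ^ 2))) := by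
  have h := integrable_exp_neg_mul_sq (b := 1 / (4 * s ^ 2)) (by positivity)
  have := h.mul_prod h
  refine this.congr (ae_of_all _ fun z => ?_)
  simp only
  rw [← Real.exp_add]; congr 1; ring

lemma pair_gauss (ψ : SchwartzMap (ℝ × ℝ) ℂ) (s : ℝ) (hs : 0 < s) :
    ∫ z : ℝ × ℝ, (Real.exp (-((z.1 ^ 2 + z.2 ^ 2) / (4 * s ^ 2))) : ℂ) * BigPsi ψ z =
    ∫ v : ℝ × ℝ, (4 * Real.pi * s ^ 2 * Real.exp (- (s ^ 2 * (v.1 ^ 2 + v.2 ^ 2))) : ℝ) * ψ v := by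
  unfold BigPsi
  simp_rw [← integral_const_mul]
  rw [integral_integral_swap]
  · congr 1; ext v
    rw [← gauss2 s hs v, ← integral_mul_const]
    congr 1; ext z; ring
  · have h1 : Integrable (fun z : ℝ × ℝ => (Real.exp (-((z.1 ^ 2 + z.2 ^ 2) / (4 * s ^ 2))) : ℂ)) :=
      (gauss_integrable2 s hs).ofReal
    have h2 := h1.mul_prod (ψ.integrable (μ := volume))
    have h3 := h2.mul_bdd (c := 1) (g := fun p : (ℝ × ℝ) × (ℝ × ℝ) =>
        Complex.exp (-Complex.I * ((p.1.1 * p.2.1 + p.1.2 * p.2.2 : ℝ) : ℂ)))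
        (by
          apply Continuous.aestronglyMeasurable
          fun_prop) (ae_of_all _ fun p => by
          rw [show -Complex.I * ((p.1.1 * p.2.1 + p.1.2 * p.2.2 : ℝ) : ℂ) =
            ((-(p.1.1 * p.2.1 + p.1.2 * p.2.2) : ℝ) : ℂ) * Complex.I by push_cast; ring,
            Complex.norm_exp_ofReal_mul_I])
    refine h3.congr (ae_of_all _ fun p => ?_)
    simp only [Function.uncurry]
    ring

lemma yukawa (ψ : SchwartzMap (ℝ × ℝ) ℂ) (hΨ : Integrable (BigPsi ψ)) (c κ : ℝ) (hc : 0 < c) (hκ : 0 < κ) :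
    ∫ z : ℝ × ℝ, ((Real.exp (-(√(z.1 ^ 2 + z.2 ^ 2 + c ^ 2) * κ)) /
        (4 * Real.pi * √(z.1 ^ 2 + z.2 ^ 2 + c ^ 2)) : ℝ) : ℂ) * BigPsi ψ z =
    ∫ v : ℝ × ℝ, ((Real.exp (-(c * √(v.1 ^ 2 + v.2 ^ 2 + κ ^ 2))) /
        (2 * √(v.1 ^ 2 + v.2 ^ 2 + κ ^ 2)) : ℝ) : ℂ) * ψ v := by
  have hpi : 0 < √Real.pi := Real.sqrt_pos.2 Real.pi_pos
  have hpi2 : √Real.pi * √Real.pi = Real.pi := Real.mul_self_sqrt Real.pi_pos.le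
  have hr : ∀ z : ℝ × ℝ, c ≤ √(z.1 ^ 2 + z.2 ^ 2 + c ^ 2) := fun z =>
    Real.le_sqrt_of_sq_le (by nlinarith [sq_nonneg z.1, sq_nonneg z.2])
  have hm : ∀ z : ℝ × ℝ, κ ≤ √(z.1 ^ 2 + z.2 ^ 2 + κ ^ 2) := fun z =>
    Real.le_sqrt_of_sq_le (by nlinarith [sq_nonneg z.1, sq_nonneg z.2])
  have hr2 : ∀ z : ℝ × ℝ, √(z.1 ^ 2 + z.2 ^ 2 + c ^ 2) ^ 2 = z.1 ^ 2 + z.2 ^ 2 + c ^ 2 := fun z =>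
    Real.sq_sqrt (by positivity)
  have hm2 : ∀ z : ℝ × ℝ, √(z.1 ^ 2 + z.2 ^ 2 + κ ^ 2) ^ 2 = z.1 ^ 2 + z.2 ^ 2 + κ ^ 2 := fun z =>
    Real.sq_sqrt (by positivity)
  rw [fubini_kernel (M := 1 / (4 * Real.pi * c)) (K := fun z s => (4 * Real.pi * √Real.pi)⁻¹ *
      (Real.exp (-((z.1 ^ 2 + z.2 ^ 2 + c ^ 2) / (4 * s ^ 2)) - κ ^ 2 * s ^ 2) / s ^ 2)) ?_ ?_ ?_ ?_ ?_ hΨ,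
    fubini_kernel (M := 1 / (2 * κ)) (K := fun v s => (√Real.pi)⁻¹ *
      Real.exp (-(c ^ 2 / (4 * s ^ 2)) - (v.1 ^ 2 + v.2 ^ 2 + κ ^ 2) * s ^ 2)) ?_ ?_ ?_ ?_ ?_
      (ψ.integrable (μ := volume))]
  · refine setIntegral_congr_fun measurableSet_Ioi fun s hs => ?_
    have hs' : 0 < s := hs
    have h := congrArg (fun w : ℂ => (((4 * Real.pi * √Real.pi)⁻¹ *
      (Real.exp (-(c ^ 2 / (4 * s ^ 2)) - κ ^ 2 * s ^ 2) / s ^ 2) : ℝ) : ℂ) * w) (pair_gauss ψ s hs)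
    simp only [← integral_const_mul] at h
    convert! h using 1
    · congr 1; ext z
      rw [← mul_assoc, ← Complex.ofReal_mul]
      congr 2
      have : Real.exp (-((z.1 ^ 2 + z.2 ^ 2 + c ^ 2) / (4 * s ^ 2)) - κ ^ 2 * s ^ 2) =
        Real.exp (-(c ^ 2 / (4 * s ^ 2)) - κ ^ 2 * s ^ 2) *
          Real.exp (-((z.1 ^ 2 + z.2 ^ 2) / (4 * s ^ 2))) := by
        rw [← Real.exp_add]; congr 1; ring
      rw [this]
      ring
    · congr 1; ext z
      rw [← mul_assoc, ← Complex.ofReal_mul]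
      congr 2
      have : Real.exp (-(c ^ 2 / (4 * s ^ 2)) - (z.1 ^ 2 + z.2 ^ 2 + κ ^ 2) * s ^ 2) =
        Real.exp (-(c ^ 2 / (4 * s ^ 2)) - κ ^ 2 * s ^ 2) * Real.exp (- (s ^ 2 * (z.1 ^ 2 + z.2 ^ 2))) := by
        rw [← Real.exp_add]; congr 1; ring
      rw [this]
      field_simp
  · unfold Function.uncurry; fun_prop
  · intro x s; positivity
  · intro v
    have := (subord c _ hc (hκ.trans_le (hm v))).1.1
    rw [hm2] at this
    exact this.const_mul _
  · intro v
    have := (subord c _ hc (hκ.trans_le (hm v))).1.2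
    rw [hm2] at this
    rw [integral_const_mul, this]
    have := hκ.trans_le (hm v)
    field_simp
  · intro v
    have := hκ.trans_le (hm v)
    have h1 : Real.exp (-(c * √(v.1 ^ 2 + v.2 ^ 2 + κ ^ 2))) ≤ 1 := Real.exp_le_one_iff.2 (by
      have := mul_pos hc this; linarith)
    gcongr
    exact hm v
  · unfold Function.uncurry; fun_prop
  · intro x s; positivity
  · intro v
    have := (subord _ κ (hc.trans_le (hr v)) hκ).2.1
    rw [hr2] at this
    exact this.const_mul _
  · intro v
    have := (subord _ κ (hc.trans_le (hr v)) hκ).2.2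
    rw [hr2] at this
    rw [integral_const_mul, this]
    have := hc.trans_le (hr v)
    field_simp
  · intro v
    have := hc.trans_le (hr v)
    have h1 : Real.exp (-(√(v.1 ^ 2 + v.2 ^ 2 + c ^ 2) * κ)) ≤ 1 := Real.exp_le_one_iff.2 (by
      have := mul_pos this hκ; linarith)
    gcongr
    exact hr v

end Yukawa
section Holomorphic
open Set Filter Topology

lemma bigPsi_integrable (ψ : SchwartzMap (ℝ × ℝ) ℂ) : Integrable (BigPsi ψ) := by
  let e := WithLp.prodContinuousLinearEquiv 2 ℝ ℝ ℝ
  let φ : SchwartzMap (WithLp 2 (ℝ × ℝ)) ℂ := SchwartzMap.compCLMOfContinuousLinearEquiv ℂ e ψ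
  have h1 : Integrable (FourierTransform.fourier φ : WithLp 2 (ℝ × ℝ) → ℂ) := SchwartzMap.integrable _
  have h2 := (WithLp.volume_preserving_toLp ℝ ℝ).integrable_comp_of_integrable h1
  have h3 := h2.comp_smul (R := (2 * Real.pi)⁻¹) (by positivity)
  refine h3.congr (ae_of_all _ fun x => ?_)
  simp only [Function.comp]
  rw [SchwartzMap.fourier_coe, Real.fourier_eq' ,
    ← (WithLp.volume_preserving_toLp ℝ ℝ).integral_comp
      (MeasurableEquiv.toLp 2 (ℝ × ℝ)).measurableEmbedding]
  unfold BigPsi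
  congr 1; ext v
  have : φ (WithLp.toLp 2 v) = ψ v := rfl
  rw [this, smul_eq_mul, mul_comm]
  congr 2
  have : inner ℝ (WithLp.toLp 2 v) (WithLp.toLp 2 ((2 * Real.pi)⁻¹ • x)) =
    (2 * Real.pi)⁻¹ * (x.1 * v.1 + x.2 * v.2) := by
    simp [WithLp.prod_inner_apply]; ring
  rw [this]
  have := Real.pi_ne_zero
  push_cast
  field_simp

lemma holo_param {α : Type*} [MeasurableSpace α] {μ : Measure α} {U : Set ℂ}
    {f : ℂ → α → ℂ} (hm : ∀ w ∈ U, AEStronglyMeasurable (f w) μ)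
    (hd : ∀ x, DifferentiableOn ℂ (fun w => f w x) U)
    (hb : ∀ w₀ ∈ U, ∃ r > 0, Metric.ball w₀ r ⊆ U ∧ ∃ b : α → ℝ, Integrable b μ ∧
      ∀ w ∈ Metric.ball w₀ r, ∀ x, ‖f w x‖ ≤ b x) :
    DifferentiableOn ℂ (fun w => ∫ x, f w x ∂μ) U := by
  intro w₀ hw₀
  obtain ⟨r, hr, hrU, b, hbi, hbb⟩ := hb w₀ hw₀
  apply DifferentiableAt.differentiableWithinAt
  have hUn : U ∈ 𝓝 w₀ := Filter.mem_of_superset (Metric.ball_mem_nhds w₀ hr) hrU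
  have hsub : ∀ w ∈ Metric.ball w₀ (r/2), Metric.closedBall w (r/3) ⊆ Metric.ball w₀ r := by
    intro w hw y hy
    rw [Metric.mem_ball] at *
    rw [Metric.mem_closedBall] at hy
    linarith [dist_triangle y w w₀]
  have hdiff : ∀ x, ∀ w ∈ Metric.ball w₀ r, HasDerivAt (fun w => f w x) (deriv (fun w => f w x) w) w := by
    intro x w hw
    exact (((hd x).mono hrU).differentiableAt (Metric.isOpen_ball.mem_nhds hw)).hasDerivAt
  have hmd : AEStronglyMeasurable (fun x => deriv (fun w => f w x) w₀) μ := by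
    have hu : ∀ n : ℕ, w₀ + ((r / 2 / (n + 1) : ℝ) : ℂ) ∈ Metric.ball w₀ r := by
      intro n
      rw [Metric.mem_ball, dist_eq_norm, add_sub_cancel_left, Complex.norm_real, Real.norm_of_nonneg (by positivity)]
      rw [div_lt_iff₀ (by positivity)]
      have : (0:ℝ) ≤ n := by positivity
      nlinarith
    refine aestronglyMeasurable_of_tendsto_ae atTop (f := fun (n : ℕ) x =>
      slope (fun w => f w x) w₀ (w₀ + ((r / 2 / (n + 1) : ℝ) : ℂ))) (fun n => ?_) (ae_of_all _ fun x => ?_)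
    · simp only [slope_def_module]
      exact ((hm _ (hrU (hu n))).sub (hm _ hw₀)).const_smul (w₀ + ((r / 2 / (n + 1) : ℝ) : ℂ) - w₀)⁻¹
    · have := hasDerivAt_iff_tendsto_slope.1 (hdiff x w₀ (Metric.mem_ball_self hr))
      refine this.comp (tendsto_nhdsWithin_iff.2 ⟨?_, ?_⟩)
      · have h1 : Tendsto (fun n : ℕ => r / 2 / ((n:ℝ) + 1)) atTop (𝓝 0) := by
          have := (tendsto_one_div_add_atTop_nhds_zero_nat (𝕜 := ℝ)).const_mul (r/2)
          simpa [div_eq_mul_inv] using this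
        have h2 := ((Complex.continuous_ofReal.tendsto 0).comp h1).const_add w₀
        simpa using h2
      · refine Eventually.of_forall fun n => ?_
        have : ((r / 2 / (n + 1) : ℝ) : ℂ) ≠ 0 := by
          exact_mod_cast (by positivity : r / 2 / ((n:ℝ) + 1) ≠ 0)
        simpa using this
  refine (hasDerivAt_integral_of_dominated_loc_of_deriv_le (F := f)
    (F' := fun w x => deriv (fun w => f w x) w) (bound := fun x => b x / (r / 3))
    (Metric.ball_mem_nhds w₀ (half_pos hr)) ?_ ?_ hmd (ae_of_all _ fun x w hw => ?_) (hbi.div_const _)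
    (ae_of_all _ fun x w hw => ?_)).2.differentiableAt
  · filter_upwards [hUn] with w hw using hm w hw
  · exact hbi.mono' (hm _ hw₀) (ae_of_all _ (hbb w₀ (Metric.mem_ball_self hr)))
  · refine Complex.norm_deriv_le_of_forall_mem_sphere_norm_le (by positivity) ?_ ?_
    · refine DifferentiableOn.diffContOnCl ((hd x).mono ?_)
      exact (Metric.closure_ball_subset_closedBall.trans (hsub w hw)).trans hrU
    · intro z hz
      exact hbb z (hsub w hw (Metric.sphere_subset_closedBall hz)) x
  · exact hdiff x w (Metric.ball_subset_ball (by linarith) hw)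

/-- The principal square root (away from `0`). -/
noncomputable def cS (w : ℂ) : ℂ := Complex.exp (Complex.log w / 2)

lemma cS_sq {w : ℂ} (hw : w ≠ 0) : cS w ^ 2 = w := by
  rw [cS, ← Complex.exp_nat_mul]
  rw [show ((2:ℕ):ℂ) * (Complex.log w / 2) = Complex.log w by push_cast; ring, Complex.exp_log hw]

lemma cS_norm {w : ℂ} (hw : w ≠ 0) : ‖cS w‖ = √‖w‖ := by
  have := congrArg norm (cS_sq hw)
  rw [norm_pow] at this
  rw [← this, Real.sqrt_sq (norm_nonneg _)]

lemma cS_re (w : ℂ) : 0 ≤ (cS w).re := by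
  rw [cS, Complex.exp_re]
  refine mul_nonneg (Real.exp_pos _).le (Real.cos_nonneg_of_mem_Icc ?_)
  have h : (Complex.log w / 2).im = Complex.arg w / 2 := by
    rw [show (2:ℂ) = ((2:ℝ):ℂ) by norm_num, Complex.div_ofReal_im, Complex.log_im]
  rw [h]
  constructor <;> linarith [Complex.neg_pi_lt_arg w, Complex.arg_le_pi w, Real.pi_pos]

lemma cS_ne (w : ℂ) : cS w ≠ 0 := Complex.exp_ne_zero _

lemma cS_pos {x : ℝ} (hx : 0 < x) : cS (x : ℂ) = (√x : ℝ) := by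
  rw [cS, ← Complex.ofReal_log hx.le, Real.sqrt_eq_rpow, Real.rpow_def_of_pos hx]
  push_cast; congr 1; ring

lemma cS_diff : DifferentiableOn ℂ cS Complex.slitPlane := by
  intro w hw
  exact ((Complex.differentiableAt_log hw).div_const 2).cexp.differentiableWithinAt

@[fun_prop]
lemma cS_meas : Measurable cS := by
  unfold cS; fun_prop

lemma exp_cS_norm (w : ℂ) {c : ℝ} (hc : 0 ≤ c) : ‖Complex.exp (-(c : ℂ) * cS w)‖ ≤ 1 := by
  rw [Complex.norm_exp, Real.exp_le_one_iff]
  have : (-(c : ℂ) * cS w).re = -(c * (cS w).re) := by simp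
  rw [this]
  have := mul_nonneg hc (cS_re w)
  linarith

noncomputable def fF (c : ℝ) (w : ℂ) (z : ℝ × ℝ) : ℂ :=
  Complex.exp (-((√(z.1 ^ 2 + z.2 ^ 2 + c ^ 2) : ℝ) : ℂ) * cS w) /
    (4 * Real.pi * √(z.1 ^ 2 + z.2 ^ 2 + c ^ 2) : ℝ)

noncomputable def gG (c : ℝ) (w : ℂ) (v : ℝ × ℝ) : ℂ :=
  Complex.exp (-(c : ℂ) * cS ((v.1 ^ 2 + v.2 ^ 2 : ℝ) + w)) /
    (2 * cS ((v.1 ^ 2 + v.2 ^ 2 : ℝ) + w))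

lemma fF_norm (c : ℝ) (hc : 0 < c) (w : ℂ) (z : ℝ × ℝ) : ‖fF c w z‖ ≤ 1 / (4 * Real.pi * c) := by
  have hr : c ≤ √(z.1 ^ 2 + z.2 ^ 2 + c ^ 2) :=
    Real.le_sqrt_of_sq_le (by nlinarith [sq_nonneg z.1, sq_nonneg z.2])
  unfold fF
  rw [norm_div, Complex.norm_real, Real.norm_of_nonneg (by positivity)]
  have := exp_cS_norm w (Real.sqrt_nonneg (z.1 ^ 2 + z.2 ^ 2 + c ^ 2))
  have := Real.pi_pos
  gcongr

lemma gG_norm (c : ℝ) (hc : 0 < c) (w : ℂ) (v : ℝ × ℝ) (h : ((v.1 ^ 2 + v.2 ^ 2 : ℝ) : ℂ) + w ≠ 0) :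
    ‖gG c w v‖ ≤ 1 / (2 * √‖((v.1 ^ 2 + v.2 ^ 2 : ℝ) : ℂ) + w‖) := by
  unfold gG
  rw [norm_div, norm_mul, cS_norm h]
  have := exp_cS_norm ((v.1 ^ 2 + v.2 ^ 2 : ℝ) + w) hc.le
  have h2 : ‖(2:ℂ)‖ = 2 := by simp
  rw [h2]
  gcongr

lemma slit_add {w : ℂ} (hw : w ∈ Complex.slitPlane) {t : ℝ} (ht : 0 ≤ t) :
    (t : ℂ) + w ∈ Complex.slitPlane := by
  rw [Complex.mem_slitPlane_iff] at *
  simp only [Complex.add_re, Complex.ofReal_re, Complex.add_im, Complex.ofReal_im, zero_add]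
  rcases hw with h | h
  · left; linarith
  · right; exact h

lemma F_diff (c : ℝ) (hc : 0 < c) (Ψ : ℝ × ℝ → ℂ) (hΨ : Integrable Ψ) :
    DifferentiableOn ℂ (fun w => ∫ z, fF c w z * Ψ z) Complex.slitPlane := by
  refine holo_param (fun w _ => ?_) (fun z => ?_) (fun w₀ hw₀ => ?_)
  · have : Measurable (fF c w) := by unfold fF; fun_prop
    exact this.aestronglyMeasurable.mul hΨ.aestronglyMeasurable
  · refine DifferentiableOn.mul_const ?_ _
    exact ((cS_diff.const_mul _).cexp).div_const _
  · obtain ⟨r, hr, h⟩ := Metric.isOpen_iff.1 Complex.isOpen_slitPlane w₀ hw₀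
    refine ⟨r, hr, h, fun z => 1 / (4 * Real.pi * c) * ‖Ψ z‖, hΨ.norm.const_mul _, fun w _ z => ?_⟩
    rw [norm_mul]
    refine mul_le_mul_of_nonneg_right ?_ (norm_nonneg _)
    exact fF_norm c hc w z

lemma G_diff (c : ℝ) (hc : 0 < c) (ψ : ℝ × ℝ → ℂ) (hψ : Integrable ψ) :
    DifferentiableOn ℂ (fun w => ∫ z, gG c w z * ψ z) Complex.slitPlane := by
  refine holo_param (fun w _ => ?_) (fun z => ?_) (fun w₀ hw₀ => ?_)
  · have : Measurable (gG c w) := by unfold gG; fun_prop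
    exact this.aestronglyMeasurable.mul hψ.aestronglyMeasurable
  · refine DifferentiableOn.mul_const ?_ _
    have h1 : DifferentiableOn ℂ (fun w => cS ((z.1 ^ 2 + z.2 ^ 2 : ℝ) + w)) Complex.slitPlane :=
      cS_diff.comp (by fun_prop) (fun w hw => slit_add hw (by positivity))
    exact ((h1.const_mul _).cexp).div (h1.const_mul _) (fun w _ => mul_ne_zero two_ne_zero (cS_ne _))
  · obtain ⟨r, hr, h⟩ := Metric.isOpen_iff.1 Complex.isOpen_slitPlane w₀ hw₀
    refine ⟨r / 2, by positivity, (Metric.ball_subset_ball (by linarith)).trans h,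
      fun z => 1 / (2 * √(r / 2)) * ‖ψ z‖, hψ.norm.const_mul _, fun w hw z => ?_⟩
    rw [norm_mul]
    refine mul_le_mul_of_nonneg_right ?_ (norm_nonneg _)
    have hw' : w ∈ Complex.slitPlane := h (Metric.ball_subset_ball (by linarith) hw)
    have hs := slit_add hw' (t := z.1 ^ 2 + z.2 ^ 2) (by positivity)
    refine (gG_norm c hc w z (Complex.slitPlane_ne_zero hs)).trans ?_
    have : r / 2 ≤ ‖((z.1 ^ 2 + z.2 ^ 2 : ℝ) : ℂ) + w‖ := by
      by_contra hlt
      push Not at hlt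
      have hin : (-((z.1 ^ 2 + z.2 ^ 2 : ℝ) : ℂ)) ∈ Metric.ball w₀ r := by
        rw [Metric.mem_ball] at *
        have h3 : dist (-((z.1 ^ 2 + z.2 ^ 2 : ℝ) : ℂ)) w = ‖((z.1 ^ 2 + z.2 ^ 2 : ℝ) : ℂ) + w‖ := by
          rw [dist_eq_norm, ← norm_neg]; congr 1; ring
        linarith [dist_triangle (-((z.1 ^ 2 + z.2 ^ 2 : ℝ) : ℂ)) w w₀]
      have := h hin
      rw [← Complex.ofReal_neg, Complex.ofReal_mem_slitPlane] at this
      nlinarith [sq_nonneg z.1, sq_nonneg z.2]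
    gcongr

lemma FG_eq (c : ℝ) (hc : 0 < c) (ψ : SchwartzMap (ℝ × ℝ) ℂ) (w : ℂ) (hw : w ∈ Complex.slitPlane) :
    ∫ z, fF c w z * BigPsi ψ z = ∫ v, gG c w v * ψ v := by
  have hpos : ∀ x : ℝ, 0 < x → ∫ z, fF c x z * BigPsi ψ z = ∫ v, gG c x v * ψ v := by
    intro x hx
    have h := yukawa ψ (bigPsi_integrable ψ) c (√x) hc (Real.sqrt_pos.2 hx)
    convert! h using 1
    · congr 1; ext z
      unfold fF
      rw [cS_pos hx]
      push_cast; ring_nf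
    · congr 1; ext z
      unfold gG
      rw [← Complex.ofReal_add, cS_pos (by positivity), Real.sq_sqrt hx.le]
      push_cast; ring_nf
  have hF := (F_diff c hc _ (bigPsi_integrable ψ)).analyticOnNhd Complex.isOpen_slitPlane
  have hG := (G_diff c hc _ (ψ.integrable (μ := volume))).analyticOnNhd Complex.isOpen_slitPlane
  refine hF.eqOn_of_preconnected_of_frequently_eq hG
    (Complex.starConvex_one_slitPlane.isPathConnected
      Complex.one_mem_slitPlane).isConnected.isPreconnected
    Complex.one_mem_slitPlane ?_ hw
  have ht : Tendsto (fun n : ℕ => (((1 + 1 / ((n:ℝ) + 1)) : ℝ) : ℂ)) atTop (𝓝[≠] 1) := by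
    refine tendsto_nhdsWithin_iff.2 ⟨?_, Eventually.of_forall fun n => ?_⟩
    · have h1 := (tendsto_one_div_add_atTop_nhds_zero_nat (𝕜 := ℝ)).const_add 1
      have := (Complex.continuous_ofReal.tendsto _).comp h1
      simpa [Function.comp_def] using this
    · have : (1 + 1 / ((n:ℝ) + 1)) ≠ 1 := by
        have : 0 < 1 / ((n:ℝ) + 1) := by positivity
        linarith
      simp only [mem_compl_iff, mem_singleton_iff]
      exact_mod_cast this
  refine ht.frequently (Frequently.of_forall fun n => ?_)
  exact hpos _ (by positivity)

end Holomorphic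
section Limit
open Set Filter Topology

lemma sqrt_sing_integrable (k : ℝ) :
    Integrable fun r : ℝ => (Ioc (-1:ℝ) 1).indicator (fun x => (√|x|)⁻¹) (r - k) := by
  have h : IntervalIntegrable (fun x : ℝ => (x : ℂ) ^ ((-(1/2) : ℝ) : ℂ)) volume (-1) 1 :=
    intervalIntegral.intervalIntegrable_cpow' (by rw [Complex.ofReal_re]; norm_num)
  rw [intervalIntegrable_iff_integrableOn_Ioc_of_le (by norm_num)] at h
  have h2 : IntegrableOn (fun x : ℝ => (√|x|)⁻¹) (Ioc (-1) 1) := by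
    refine h.norm.congr (ae_of_all _ fun x => ?_)
    simp only
    rw [Complex.norm_cpow_real, Complex.norm_real, Real.norm_eq_abs, Real.rpow_neg (abs_nonneg _),
      Real.sqrt_eq_rpow]
  exact (h2.integrable_indicator measurableSet_Ioc).comp_sub_right k

lemma radial_bound (k : ℝ) (hk : 0 < k) (r : ℝ) (hr : 0 < r) :
    r * (((1 + r ^ 2) ^ 2)⁻¹ * (√|r ^ 2 - k ^ 2|)⁻¹) ≤
      (√k)⁻¹ * ((1 + r ^ 2)⁻¹ + (Ioc (-1:ℝ) 1).indicator (fun x => (√|x|)⁻¹) (r - k)) := by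
  have h1 : (√|r ^ 2 - k ^ 2|)⁻¹ ≤ (√k)⁻¹ * (√|r - k|)⁻¹ := by
    rcases eq_or_ne r k with rfl | hne
    · simp
    · have h0 : 0 < |r - k| := abs_pos.2 (sub_ne_zero.2 hne)
      rw [← mul_inv, ← Real.sqrt_mul hk.le]
      have : k * |r - k| ≤ |r ^ 2 - k ^ 2| := by
        rw [show r ^ 2 - k ^ 2 = (r + k) * (r - k) by ring, abs_mul, abs_of_pos (by positivity : 0 < r + k)]
        nlinarith
      have : 0 < √(k * |r - k|) := Real.sqrt_pos.2 (by positivity)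
      gcongr
  have h2 : r * ((1 + r ^ 2) ^ 2)⁻¹ ≤ (1 + r ^ 2)⁻¹ := by
    rw [← div_eq_mul_inv, div_le_iff₀ (by positivity), sq (1 + r ^ 2), ← mul_assoc,
      inv_mul_cancel₀ (by positivity)]
    nlinarith [sq_nonneg (r - 1)]
  have h3 : (1 + r ^ 2)⁻¹ ≤ 1 := inv_le_one_of_one_le₀ (by nlinarith [sq_nonneg r])
  have h4 : (1 + r ^ 2)⁻¹ * (√|r - k|)⁻¹ ≤
      (1 + r ^ 2)⁻¹ + (Ioc (-1:ℝ) 1).indicator (fun x => (√|x|)⁻¹) (r - k) := by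
    by_cases hm : r - k ∈ Ioc (-1:ℝ) 1
    · rw [indicator_of_mem hm]
      have : 0 ≤ (√|r - k|)⁻¹ := by positivity
      have : 0 ≤ (1 + r ^ 2)⁻¹ := by positivity
      nlinarith
    · rw [indicator_of_notMem hm, add_zero]
      have : 1 ≤ |r - k| := by
        by_contra hlt
        push Not at hlt
        rw [abs_lt] at hlt
        exact hm ⟨hlt.1, hlt.2.le⟩
      have : (√|r - k|)⁻¹ ≤ 1 := inv_le_one_of_one_le₀ (by rwa [Real.one_le_sqrt])
      exact mul_le_of_le_one_right (by positivity) this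
  calc r * (((1 + r ^ 2) ^ 2)⁻¹ * (√|r ^ 2 - k ^ 2|)⁻¹)
      = (r * ((1 + r ^ 2) ^ 2)⁻¹) * (√|r ^ 2 - k ^ 2|)⁻¹ := by ring
    _ ≤ (1 + r ^ 2)⁻¹ * ((√k)⁻¹ * (√|r - k|)⁻¹) := by gcongr
    _ = (√k)⁻¹ * ((1 + r ^ 2)⁻¹ * (√|r - k|)⁻¹) := by ring
    _ ≤ _ := by gcongr

lemma dom_integrable0 (k : ℝ) (hk : 0 < k) :
    Integrable fun v : ℝ × ℝ => ((1 + (v.1 ^ 2 + v.2 ^ 2)) ^ 2)⁻¹ * (√|v.1 ^ 2 + v.2 ^ 2 - k ^ 2|)⁻¹ := by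
  rw [← integrableOn_univ]
  refine IntegrableOn.congr_set_ae ?_ polarCoord_source_ae_eq_univ.symm
  rw [← polarCoord.symm_image_target_eq_source,
    integrableOn_image_iff_integrableOn_abs_det_fderiv_smul volume
      polarCoord.open_target.measurableSet
      (fun p _ => (hasFDerivAt_polarCoord_symm p).hasFDerivWithinAt) polarCoord.symm.injOn]
  have hI : IntegrableOn (fun p : ℝ × ℝ => ((√k)⁻¹ * ((1 + p.1 ^ 2)⁻¹ +
      (Ioc (-1:ℝ) 1).indicator (fun x => (√|x|)⁻¹) (p.1 - k))) * 1) polarCoord.target := by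
    rw [polarCoord_target, IntegrableOn, Measure.volume_eq_prod, ← Measure.prod_restrict]
    refine Integrable.mul_prod (f := fun r : ℝ => (√k)⁻¹ * ((1 + r ^ 2)⁻¹ +
      (Ioc (-1:ℝ) 1).indicator (fun x => (√|x|)⁻¹) (r - k))) (g := fun _ => (1:ℝ)) ?_ ?_
    · exact ((integrable_inv_one_add_sq.add (sqrt_sing_integrable k)).const_mul _).integrableOn
    · exact integrable_const _
  refine hI.mono' ?_ ?_
  · simp only [det_fderivPolarCoordSymm, polarCoord_symm_apply]
    apply Measurable.aestronglyMeasurable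
    fun_prop
  · refine (ae_restrict_iff' polarCoord.open_target.measurableSet).2 (ae_of_all _ fun p hp => ?_)
    have hp1 : 0 < p.1 := hp.1
    have e : (p.1 * Real.cos p.2) ^ 2 + (p.1 * Real.sin p.2) ^ 2 = p.1 ^ 2 := by
      have := Real.sin_sq_add_cos_sq p.2
      linear_combination p.1 ^ 2 * this
    simp only [det_fderivPolarCoordSymm, polarCoord_symm_apply, e, smul_eq_mul, mul_one]
    rw [Real.norm_of_nonneg (by positivity), abs_of_pos hp1]
    exact radial_bound k hk p.1 hp1

lemma dom_integrable (k : ℝ) (hk : 0 < k) (ψ : SchwartzMap (ℝ × ℝ) ℂ) :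
    Integrable fun v : ℝ × ℝ => 1 / (2 * √|v.1 ^ 2 + v.2 ^ 2 - k ^ 2|) * ‖ψ v‖ := by
  obtain ⟨C, hC⟩ : ∃ C : ℝ, ∀ v, (1 + ‖v‖) ^ 4 * ‖ψ v‖ ≤ C := by
    refine ⟨2 ^ 4 * ((Finset.Iic ((4, 0) : ℕ × ℕ)).sup
      fun m => SchwartzMap.seminorm ℝ m.1 m.2) ψ, fun v => ?_⟩
    have := SchwartzMap.one_add_le_sup_seminorm_apply (𝕜 := ℝ) (m := (4, 0)) (k := 4) (n := 0)
      le_rfl le_rfl ψ v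
    rw [norm_iteratedFDeriv_zero] at this
    exact this
  refine ((dom_integrable0 k hk).const_mul (2 * C)).mono' ?_ (ae_of_all _ fun v => ?_)
  · have h1 : Measurable fun v : ℝ × ℝ => 1 / (2 * √|v.1 ^ 2 + v.2 ^ 2 - k ^ 2|) := by fun_prop
    exact h1.aestronglyMeasurable.mul ψ.continuous.norm.aestronglyMeasurable
  · rw [Real.norm_of_nonneg (by positivity)]
    have h1 : v.1 ^ 2 ≤ ‖v‖ ^ 2 := by
      have h0 : |v.1| ≤ ‖v‖ := norm_fst_le v
      rw [← sq_abs v.1]; gcongr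
    have h2 : v.2 ^ 2 ≤ ‖v‖ ^ 2 := by
      have h0 : |v.2| ≤ ‖v‖ := norm_snd_le v
      rw [← sq_abs v.2]; gcongr
    have h3 : (1 + (v.1 ^ 2 + v.2 ^ 2)) ^ 2 ≤ 4 * (1 + ‖v‖) ^ 4 := by
      have : (1 + (v.1 ^ 2 + v.2 ^ 2)) ≤ 2 * (1 + ‖v‖) ^ 2 := by nlinarith [norm_nonneg v]
      calc _ ≤ (2 * (1 + ‖v‖) ^ 2) ^ 2 := by gcongr
        _ = _ := by ring
    have h4 : ‖ψ v‖ ≤ 4 * C * ((1 + (v.1 ^ 2 + v.2 ^ 2)) ^ 2)⁻¹ := by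
      rw [← div_eq_mul_inv, le_div_iff₀ (by positivity)]
      nlinarith [hC v, norm_nonneg (ψ v), mul_le_mul_of_nonneg_left h3 (norm_nonneg (ψ v))]
    calc _ ≤ 1 / (2 * √|v.1 ^ 2 + v.2 ^ 2 - k ^ 2|) * (4 * C * ((1 + (v.1 ^ 2 + v.2 ^ 2)) ^ 2)⁻¹) := by gcongr
      _ = _ := by rw [one_div, mul_inv]; ring

lemma circle_ae (k : ℝ) : ∀ᵐ v : ℝ × ℝ, v.1 ^ 2 + v.2 ^ 2 ≠ k ^ 2 := by
  have hms : MeasurableSet {v : ℝ × ℝ | v.1 ^ 2 + v.2 ^ 2 = k ^ 2} :=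
    measurableSet_eq_fun (by fun_prop) (by fun_prop)
  have : (volume : Measure (ℝ × ℝ)) {v : ℝ × ℝ | v.1 ^ 2 + v.2 ^ 2 = k ^ 2} = 0 := by
    rw [Measure.volume_eq_prod, Measure.measure_prod_null hms]
    refine ae_of_all _ fun x => ?_
    have hsub : Prod.mk x ⁻¹' {v : ℝ × ℝ | v.1 ^ 2 + v.2 ^ 2 = k ^ 2} ⊆
        {√(k ^ 2 - x ^ 2), -√(k ^ 2 - x ^ 2)} := by
      intro y hy
      have hy' : x ^ 2 + y ^ 2 = k ^ 2 := hy
      have : y ^ 2 = √(k ^ 2 - x ^ 2) ^ 2 := by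
        rw [Real.sq_sqrt (by nlinarith [sq_nonneg y])]; linarith
      rcases sq_eq_sq_iff_eq_or_eq_neg.1 this with h | h <;> simp [h]
    exact measure_mono_null hsub ((Set.toFinite _).measure_zero _)
  rw [ae_iff]
  simpa using this

lemma wlim (t : ℝ) : Tendsto (fun n : ℕ => (t : ℂ) - ((1 / ((n:ℝ) + 1) : ℝ) : ℂ) * Complex.I) atTop
    (𝓝[{z : ℂ | z.im < 0}] (t : ℂ)) := by
  refine tendsto_nhdsWithin_iff.2 ⟨?_, Eventually.of_forall fun n => ?_⟩
  · have h1 := (Complex.continuous_ofReal.tendsto _).comp (tendsto_one_div_add_atTop_nhds_zero_nat (𝕜 := ℝ))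
    have h2 := (h1.mul_const Complex.I).const_sub (t:ℂ)
    simpa [Function.comp_def] using h2
  · have : 0 < 1 / ((n:ℝ) + 1) := by positivity
    have e : ((t : ℂ) - ((1 / ((n:ℝ) + 1) : ℝ) : ℂ) * Complex.I).im = -(1 / ((n:ℝ) + 1)) := by
      rw [Complex.sub_im, Complex.im_ofReal_mul]; simp
    change _ < (0:ℝ)
    rw [e]; linarith

lemma cS_lim_pos {t : ℝ} (ht : 0 < t) :
    Tendsto (fun n : ℕ => cS ((t : ℂ) - ((1 / ((n:ℝ) + 1) : ℝ) : ℂ) * Complex.I)) atTop (𝓝 ((√t : ℝ) : ℂ)) := by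
  have h : ContinuousAt cS (t : ℂ) :=
    (cS_diff.differentiableAt (Complex.isOpen_slitPlane.mem_nhds (Complex.ofReal_mem_slitPlane.2 ht))).continuousAt
  rw [← cS_pos ht]
  exact h.tendsto.comp (tendsto_nhdsWithin_iff.1 (wlim t)).1

lemma cS_lim_neg {t : ℝ} (ht : t < 0) :
    Tendsto (fun n : ℕ => cS ((t : ℂ) - ((1 / ((n:ℝ) + 1) : ℝ) : ℂ) * Complex.I)) atTop
      (𝓝 (-Complex.I * (√(-t) : ℝ))) := by
  have h := (Complex.tendsto_log_nhdsWithin_im_neg_of_re_neg_of_im_zero (z := (t:ℂ))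
    (by simpa using ht) (by simp)).comp (wlim t)
  have h2 := (Complex.continuous_exp.tendsto _).comp (h.div_const 2)
  convert! h2 using 2
  rw [Complex.norm_real, Real.norm_eq_abs, abs_of_neg ht, Real.sqrt_eq_rpow,
    Real.rpow_def_of_pos (by linarith : 0 < -t), sub_div, Complex.exp_sub,
    show (Real.pi : ℂ) * Complex.I / 2 = Real.pi / 2 * Complex.I by ring, Complex.exp_pi_div_two_mul_I,
    Complex.div_I]
  push_cast
  rw [show (Real.log (-t) : ℂ) * (1 / 2) = Real.log (-t) / 2 by ring]
  ring

lemma I1_meas (k a : ℝ) : Measurable (I1 k a) := by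
  unfold I1
  refine Measurable.ite (measurableSet_lt (by fun_prop) (by fun_prop)) ?_ ?_ <;> fun_prop

lemma I1_norm (k a : ℝ) (ha : a < 0) (v : ℝ × ℝ) :
    ‖I1 k a v‖ ≤ 1 / (2 * √|v.1 ^ 2 + v.2 ^ 2 - k ^ 2|) := by
  unfold I1
  have h2 : ‖(2:ℂ)‖ = 2 := by simp
  split_ifs with h
  · rw [norm_div, norm_mul, norm_mul, h2, Complex.norm_I, Complex.norm_real, Real.norm_of_nonneg (Real.sqrt_nonneg _),
      show -Complex.I * (a:ℂ) * (√(k ^ 2 - v.1 ^ 2 - v.2 ^ 2) : ℝ) =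
        ((-a * √(k ^ 2 - v.1 ^ 2 - v.2 ^ 2) : ℝ) : ℂ) * Complex.I by push_cast; ring,
      Complex.norm_exp_ofReal_mul_I, abs_of_neg (by linarith),
      show -(v.1 ^ 2 + v.2 ^ 2 - k ^ 2) = k ^ 2 - v.1 ^ 2 - v.2 ^ 2 by ring, one_mul]
  · rw [norm_div, norm_mul, h2, Complex.norm_real, Real.norm_of_nonneg (Real.sqrt_nonneg _),
      abs_of_nonneg (by linarith), ← Complex.ofReal_mul, Complex.norm_exp, Complex.ofReal_re]
    gcongr
    rw [Real.exp_le_one_iff]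
    exact mul_nonpos_of_nonpos_of_nonneg ha.le (Real.sqrt_nonneg _)

lemma gG_lim (k a : ℝ) (v : ℝ × ℝ) (hv : v.1 ^ 2 + v.2 ^ 2 ≠ k ^ 2) :
    Tendsto (fun n : ℕ => gG (-a) (((-k ^ 2 : ℝ) : ℂ) - ((1 / ((n:ℝ) + 1) : ℝ) : ℂ) * Complex.I) v) atTop
      (𝓝 (I1 k a v)) := by
  unfold gG
  have e : ∀ n : ℕ, ((v.1 ^ 2 + v.2 ^ 2 : ℝ) : ℂ) + (((-k ^ 2 : ℝ) : ℂ) - ((1 / ((n:ℝ) + 1) : ℝ) : ℂ) * Complex.I) =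
      ((v.1 ^ 2 + v.2 ^ 2 - k ^ 2 : ℝ) : ℂ) - ((1 / ((n:ℝ) + 1) : ℝ) : ℂ) * Complex.I := by
    intro n; push_cast; ring
  simp_rw [e]
  unfold I1
  split_ifs with h
  · have hl := cS_lim_neg (t := v.1 ^ 2 + v.2 ^ 2 - k ^ 2) (by linarith)
    rw [show -(v.1 ^ 2 + v.2 ^ 2 - k ^ 2) = k ^ 2 - v.1 ^ 2 - v.2 ^ 2 by ring] at hl
    have hs : 0 < √(k ^ 2 - v.1 ^ 2 - v.2 ^ 2) := Real.sqrt_pos.2 (by linarith)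
    have hs' : ((√(k ^ 2 - v.1 ^ 2 - v.2 ^ 2) : ℝ) : ℂ) ≠ 0 := by exact_mod_cast hs.ne'
    have := ((Complex.continuous_exp.tendsto _).comp (hl.const_mul (-((-a : ℝ) : ℂ)))).div (hl.const_mul 2)
      (mul_ne_zero two_ne_zero (mul_ne_zero (neg_ne_zero.2 Complex.I_ne_zero) hs'))
    convert! this using 2
    rw [show -((-a : ℝ) : ℂ) * (-Complex.I * (√(k ^ 2 - v.1 ^ 2 - v.2 ^ 2) : ℝ)) =
      -Complex.I * (a : ℂ) * (√(k ^ 2 - v.1 ^ 2 - v.2 ^ 2) : ℝ) by push_cast; ring]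
    rw [div_eq_div_iff (mul_ne_zero two_ne_zero hs')
      (mul_ne_zero two_ne_zero (mul_ne_zero (neg_ne_zero.2 Complex.I_ne_zero) hs'))]
    ring_nf
    rw [Complex.I_sq]; ring
  · have hlt : 0 < v.1 ^ 2 + v.2 ^ 2 - k ^ 2 := by
      have := lt_of_le_of_ne (not_lt.1 h) hv.symm
      linarith
    have hl := cS_lim_pos hlt
    have hs : 0 < √(v.1 ^ 2 + v.2 ^ 2 - k ^ 2) := Real.sqrt_pos.2 hlt
    have hs' : ((√(v.1 ^ 2 + v.2 ^ 2 - k ^ 2) : ℝ) : ℂ) ≠ 0 := by exact_mod_cast hs.ne'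
    have := ((Complex.continuous_exp.tendsto _).comp (hl.const_mul (-((-a : ℝ) : ℂ)))).div (hl.const_mul 2)
      (mul_ne_zero two_ne_zero hs')
    convert! this using 2
    push_cast; ring_nf

lemma fF_lim (k a : ℝ) (hk : 0 < k) (z : ℝ × ℝ) :
    Tendsto (fun n : ℕ => fF (-a) (((-k ^ 2 : ℝ) : ℂ) - ((1 / ((n:ℝ) + 1) : ℝ) : ℂ) * Complex.I) z) atTop
      (𝓝 (PhiSlice k a z)) := by
  unfold fF PhiSlice
  have hl := cS_lim_neg (t := -k ^ 2) (by nlinarith [sq_pos_of_pos hk])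
  rw [show -(-k ^ 2) = k ^ 2 by ring, Real.sqrt_sq hk.le] at hl
  have := ((Complex.continuous_exp.tendsto _).comp
    (hl.const_mul (-((√(z.1 ^ 2 + z.2 ^ 2 + (-a) ^ 2) : ℝ) : ℂ)))).div_const
      ((4 * Real.pi * √(z.1 ^ 2 + z.2 ^ 2 + (-a) ^ 2) : ℝ) : ℂ)
  convert! this using 2
  rw [neg_sq]
  push_cast
  ring_nf

end Limit

/-- The tempered-distribution Fourier transform on ℝ² of the slice
of the outgoing fundamental solution of the Helmholtz equation equals `I₁`. -/
theorem fourier_transform_of_fundamental_solution_slice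
    (k a : ℝ) (hk : 0 < k) (ha : a < 0) (ψ : SchwartzMap (ℝ × ℝ) ℂ) :
    Integrable (fun z : ℝ × ℝ => PhiSlice k a z * BigPsi ψ z) (volume : Measure (ℝ × ℝ)) ∧
    Integrable (fun v : ℝ × ℝ => I1 k a v * ψ v) (volume : Measure (ℝ × ℝ)) ∧
    ∫ z : ℝ × ℝ, PhiSlice k a z * BigPsi ψ z = ∫ v : ℝ × ℝ, I1 k a v * ψ v := by
  have hΨ := bigPsi_integrable ψ
  have hc : 0 < -a := by linarith
  have hD := dom_integrable k hk ψ
  have hFm : ∀ w, AEStronglyMeasurable (fun z => fF (-a) w z * BigPsi ψ z) volume := fun w => by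
    have : Measurable (fF (-a) w) := by unfold fF; fun_prop
    exact this.aestronglyMeasurable.mul hΨ.aestronglyMeasurable
  have hGm : ∀ w, AEStronglyMeasurable (fun z => gG (-a) w z * ψ z) volume := fun w => by
    have : Measurable (gG (-a) w) := by unfold gG; fun_prop
    exact this.aestronglyMeasurable.mul ψ.continuous.aestronglyMeasurable
  have hPm : Measurable (PhiSlice k a) := by unfold PhiSlice; fun_prop
  refine ⟨?_, ?_, ?_⟩
  · refine hΨ.bdd_mul (c := 1 / (4 * Real.pi * (-a))) hPm.aestronglyMeasurable (Filter.Eventually.of_forall fun z => ?_)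
    exact le_of_tendsto (fF_lim k a hk z).norm (Filter.Eventually.of_forall fun n => fF_norm _ hc _ _)
  · refine hD.mono' ((I1_meas k a).aestronglyMeasurable.mul ψ.continuous.aestronglyMeasurable)
      (Filter.Eventually.of_forall fun v => ?_)
    rw [norm_mul]
    exact mul_le_mul_of_nonneg_right (I1_norm k a ha v) (norm_nonneg _)
  · let w : ℕ → ℂ := fun n => ((-k ^ 2 : ℝ) : ℂ) - ((1 / ((n:ℝ) + 1) : ℝ) : ℂ) * Complex.I
    have him : ∀ (t : ℝ) (n : ℕ), (((t : ℝ) : ℂ) - ((1 / ((n:ℝ) + 1) : ℝ) : ℂ) * Complex.I).im ≠ 0 := by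
      intro t n
      have : 0 < 1 / ((n:ℝ) + 1) := by positivity
      rw [Complex.sub_im, Complex.im_ofReal_mul]
      simp only [Complex.ofReal_im, Complex.I_im, mul_one]
      linarith
    have h1 : Filter.Tendsto (fun n => ∫ z, fF (-a) (w n) z * BigPsi ψ z) Filter.atTop
        (nhds (∫ z, PhiSlice k a z * BigPsi ψ z)) := by
      refine tendsto_integral_of_dominated_convergence
        (fun z => 1 / (4 * Real.pi * (-a)) * ‖BigPsi ψ z‖) (fun n => hFm _) (hΨ.norm.const_mul _)
        (fun n => Filter.Eventually.of_forall fun z => ?_) (Filter.Eventually.of_forall fun z => ?_)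
      · rw [norm_mul]
        exact mul_le_mul_of_nonneg_right (fF_norm _ hc _ _) (norm_nonneg _)
      · exact (fF_lim k a hk z).mul_const _
    have h2 : Filter.Tendsto (fun n => ∫ v, gG (-a) (w n) v * ψ v) Filter.atTop
        (nhds (∫ v, I1 k a v * ψ v)) := by
      refine tendsto_integral_of_dominated_convergence _ (fun n => hGm _) hD
        (fun n => ?_) ?_
      · filter_upwards [circle_ae k] with v hv
        rw [norm_mul]
        refine mul_le_mul_of_nonneg_right ?_ (norm_nonneg _)
        have e : ((v.1 ^ 2 + v.2 ^ 2 : ℝ) : ℂ) + w n =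
          ((v.1 ^ 2 + v.2 ^ 2 - k ^ 2 : ℝ) : ℂ) - ((1 / ((n:ℝ) + 1) : ℝ) : ℂ) * Complex.I := by
          simp only [w]; push_cast; ring
        have hne : ((v.1 ^ 2 + v.2 ^ 2 : ℝ) : ℂ) + w n ≠ 0 := by
          intro h0
          rw [e] at h0
          exact him _ n (by rw [h0]; simp)
        refine (gG_norm _ hc _ v hne).trans ?_
        have h3 : |v.1 ^ 2 + v.2 ^ 2 - k ^ 2| ≤ ‖((v.1 ^ 2 + v.2 ^ 2 : ℝ) : ℂ) + w n‖ := by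
          rw [e]
          have h4 := Complex.abs_re_le_norm
            (((v.1 ^ 2 + v.2 ^ 2 - k ^ 2 : ℝ) : ℂ) - ((1 / ((n:ℝ) + 1) : ℝ) : ℂ) * Complex.I)
          rw [Complex.sub_re, Complex.re_ofReal_mul, Complex.I_re, mul_zero, sub_zero,
            Complex.ofReal_re] at h4
          exact h4
        have h5 : 0 < |v.1 ^ 2 + v.2 ^ 2 - k ^ 2| := abs_pos.2 (sub_ne_zero.2 hv)
        have h6 : 0 < √|v.1 ^ 2 + v.2 ^ 2 - k ^ 2| := Real.sqrt_pos.2 h5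
        gcongr
      · filter_upwards [circle_ae k] with v hv
        exact (gG_lim k a v hv).mul_const _
    have h3 : ∀ n, ∫ z, fF (-a) (w n) z * BigPsi ψ z = ∫ v, gG (-a) (w n) v * ψ v := fun n =>
      FG_eq (-a) hc ψ (w n) (Complex.mem_slitPlane_iff.2 (Or.inr (him _ n)))
    simp_rw [h3] at h1
    exact tendsto_nhds_unique h1 h2
end

section
/- Let k > 0 and let b < 0 be real numbers. For (z₁, z₂) ∈ ℝ² set r = √(z₁² + z₂² + b²) and define the double-layer (normal-derivative) kernel K_b : ℝ² → ℂ by K_b(z₁, z₂) = b · (1 − i k r) · exp(i k r) / (2π r³). Then for every Schwartz function ψ : ℝ² → ℂ, the functions (z₁,z₂) ↦ K_b(z₁,z₂) · Ψ(z₁,z₂) and (v₁,v₂) ↦ exp(−i κ(v₁,v₂) b) · ψ(v₁,v₂) are integrable on ℝ², and ∫_{ℝ²} K_b(z₁,z₂) Ψ(z₁,z₂) dz₁ dz₂ = − ∫_{ℝ²} exp(−i κ(v₁,v₂) b) ψ(v₁,v₂) dv₁ dv₂. (That is, the tempered-distribution Fourier transform on ℝ² of K_b equals −e^{−iκ b};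 here K_b(z₁,z₂) = ∂/∂y₃ [Φ_k(z₁, z₂, b − y₃) − Φ_k(z₁, z₂, b + y₃)] evaluated at y₃ = 0, where Φ_k(x) = exp(ik|x|)/(4π|x|).) -/
open MeasureTheory

/-- `κ(v) = √(k² − |v|²)` for `|v|² ≤ k²` and `κ(v) = i √(|v|² − k²)` for `|v|² > k²`. -/
noncomputable def kappa (k : ℝ) (v : ℝ × ℝ) : ℂ :=
  if v.1 ^ 2 + v.2 ^ 2 ≤ k ^ 2 then (Real.sqrt (k ^ 2 - v.1 ^ 2 - v.2 ^ 2) : ℂ)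
  else Complex.I * (Real.sqrt (v.1 ^ 2 + v.2 ^ 2 - k ^ 2) : ℂ)

/-- The double-layer (normal-derivative) kernel
`K_b(z₁,z₂) = b (1 − i k r) e^{ikr} / (2π r³)` with `r = √(z₁² + z₂² + b²)`. -/
noncomputable def Kker (k b : ℝ) (z : ℝ × ℝ) : ℂ :=
  (b : ℂ) * (1 - Complex.I * (k : ℂ) * (Real.sqrt (z.1 ^ 2 + z.2 ^ 2 + b ^ 2) : ℂ)) *
    Complex.exp (Complex.I * (k : ℂ) * (Real.sqrt (z.1 ^ 2 + z.2 ^ 2 + b ^ 2) : ℂ)) /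
    (2 * (Real.pi : ℂ) * (Real.sqrt (z.1 ^ 2 + z.2 ^ 2 + b ^ 2) : ℂ) ^ 3)

namespace DLK
open Set Filter Topology

/-- FTC on `(0,∞)` with one-sided limit at `0`. -/
lemma ftc_Ioi {g g' : ℝ → ℝ} {l m : ℝ}
    (hd : ∀ x ∈ Ioi (0:ℝ), HasDerivAt g (g' x) x) (hp : ∀ x ∈ Ioi (0:ℝ), 0 ≤ g' x)
    (h0 : Tendsto g (𝓝[>] 0) (𝓝 m)) (hi : Tendsto g atTop (𝓝 l)) :
    IntegrableOn g' (Ioi 0) ∧ ∫ x in Ioi (0:ℝ), g' x = l - m := by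
  set G : ℝ → ℝ := Function.update g 0 m with hG
  have hc : ContinuousWithinAt G (Ici 0) 0 := by
    rw [hG, continuousWithinAt_update_same]
    have : Ici (0:ℝ) \ {0} = Ioi 0 := Ici_sdiff_left
    rw [this]; exact h0
  have heq : ∀ x ∈ Ioi (0:ℝ), G =ᶠ[𝓝 x] g := by
    intro x hx
    filter_upwards [Ioi_mem_nhds hx] with y hy
    simp [hG, Function.update_of_ne (ne_of_gt (show (0:ℝ) < y from hy))]
  have hd' : ∀ x ∈ Ioi (0:ℝ), HasDerivAt G (g' x) x := fun x hx =>
    (hd x hx).congr_of_eventuallyEq (heq x hx)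
  have hi' : Tendsto G atTop (𝓝 l) := by
    refine hi.congr' ?_
    filter_upwards [Ioi_mem_atTop (0:ℝ)] with y hy
    simp [hG, Function.update_of_ne (ne_of_gt (show (0:ℝ) < y from hy))]
  refine ⟨integrableOn_Ioi_deriv_of_nonneg hc hd' hp hi', ?_⟩
  rw [integral_Ioi_of_hasDerivAt_of_nonneg hc hd' hp hi']
  simp [hG]

/-- Unnormalised error function. -/
noncomputable def erfG (x : ℝ) : ℝ := ∫ y in (0:ℝ)..x, Real.exp (-y ^ 2)

lemma erfG_deriv (x : ℝ) : HasDerivAt erfG (Real.exp (-x ^ 2)) x := by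
  have hc : Continuous fun y : ℝ => Real.exp (-y ^ 2) := by fun_prop
  exact hc.integral_hasStrictDerivAt 0 x |>.hasDerivAt

lemma gauss_int : Integrable (fun y : ℝ => Real.exp (-y ^ 2)) := by
  simpa using integrable_exp_neg_mul_sq (b := 1) one_pos

lemma erfG_top : Tendsto erfG atTop (𝓝 (Real.sqrt Real.pi / 2)) := by
  have h := intervalIntegral_tendsto_integral_Ioi (0:ℝ) gauss_int.integrableOn tendsto_id
  have h2 := integral_gaussian_Ioi 1
  simp only [neg_mul, one_mul, div_one] at h2
  rw [h2] at h
  exact h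

lemma erfG_neg (x : ℝ) : erfG (-x) = - erfG x := by
  unfold erfG
  have := intervalIntegral.integral_comp_neg (a := 0) (b := x) (fun y : ℝ => Real.exp (-y ^ 2))
  simp only [neg_sq, neg_zero] at this
  rw [this, intervalIntegral.integral_symm]

lemma erfG_bot : Tendsto erfG atBot (𝓝 (-(Real.sqrt Real.pi / 2))) := by
  have h := (erfG_top.comp tendsto_neg_atBot_atTop).neg
  refine h.congr fun x => ?_
  simp [erfG_neg]

section
variable {r s : ℝ}

lemma lim_minus_zero (hr : 0 < r) :
    Tendsto (fun x : ℝ => s * x - r / (2 * x)) (𝓝[>] 0) atBot := by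
  have h1 : Tendsto (fun x : ℝ => s * x) (𝓝[>] 0) (𝓝 0) := by
    have : Tendsto (fun x : ℝ => s * x) (𝓝 0) (𝓝 (s * 0)) := Continuous.tendsto (by fun_prop) 0
    rw [mul_zero] at this
    exact this.mono_left nhdsWithin_le_nhds
  have h2 : Tendsto (fun x : ℝ => -((r/2) * x⁻¹)) (𝓝[>] 0) atBot :=
    tendsto_neg_atTop_atBot.comp (tendsto_inv_nhdsGT_zero.const_mul_atTop (half_pos hr))
  refine (h1.add_atBot h2).congr fun x => ?_
  rw [div_mul_eq_div_div, div_eq_mul_inv (r/2) x]; ring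

lemma lim_plus_zero (hr : 0 < r) :
    Tendsto (fun x : ℝ => s * x + r / (2 * x)) (𝓝[>] 0) atTop := by
  have h := tendsto_neg_atBot_atTop.comp (lim_minus_zero (s := -s) hr)
  refine h.congr fun x => ?_
  simp only [Function.comp]; ring

lemma lim_inv_top : Tendsto (fun x : ℝ => r / (2 * x)) atTop (𝓝 0) :=
  Tendsto.div_atTop tendsto_const_nhds (tendsto_id.const_mul_atTop two_pos)

lemma lim_plus_top (hs : 0 < s) :
    Tendsto (fun x : ℝ => s * x + r / (2 * x)) atTop atTop :=
  (tendsto_id.const_mul_atTop hs).atTop_add lim_inv_top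

lemma lim_minus_top (hs : 0 < s) :
    Tendsto (fun x : ℝ => s * x - r / (2 * x)) atTop atTop := by
  have h := lim_plus_top (r := -r) hs
  refine h.congr fun x => ?_
  ring

/-- The exponential factor. -/
noncomputable def EE (r s x : ℝ) : ℝ := Real.exp (-(r ^ 2 / (4 * x ^ 2)) - s ^ 2 * x ^ 2)

lemma EE_pos (r s x : ℝ) : 0 < EE r s x := Real.exp_pos _

lemma deriv_arg (x : ℝ) (hx : 0 < x) :
    HasDerivAt (fun x : ℝ => s * x - r / (2 * x)) (s + r / (2 * x ^ 2)) x := by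
  have h1 : HasDerivAt (fun x : ℝ => s * x) s x := by
    simpa using (hasDerivAt_id x).const_mul s
  have h2 := ((hasDerivAt_inv hx.ne').const_mul (r/2))
  have h3 := h1.sub h2
  convert! h3 using 1
  · ext y
    simp only [Pi.sub_apply]
    rw [div_mul_eq_div_div, div_eq_mul_inv (r/2) y]
  · field_simp; ring

lemma deriv_minus (x : ℝ) (hx : 0 < x) :
    HasDerivAt (fun x : ℝ => Real.exp (-(s * r)) * erfG (s * x - r / (2 * x)))
      (EE r s x * (s + r / (2 * x ^ 2))) x := by
  have h := ((erfG_deriv (s * x - r / (2 * x))).comp x (deriv_arg x hx)).const_mul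
    (Real.exp (-(s * r)))
  convert! h using 1
  rw [← mul_assoc, ← Real.exp_add, EE]
  congr 2
  field_simp; ring

lemma deriv_plus (x : ℝ) (hx : 0 < x) :
    HasDerivAt (fun x : ℝ => Real.exp (s * r) * erfG (s * x + r / (2 * x)))
      (EE r s x * (s - r / (2 * x ^ 2))) x := by
  have h := deriv_minus (r := -r) (s := s) x hx
  convert! h using 1
  · ext y
    rw [mul_neg, neg_neg, neg_div, sub_neg_eq_add]
  · simp only [EE, neg_sq, neg_div]; ring

lemma deriv_EE (x : ℝ) (hx : 0 < x) :
    HasDerivAt (fun x : ℝ => x⁻¹ * EE r s x)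
      ((-(x ^ 2)⁻¹ + r ^ 2 / 2 * (x ^ 4)⁻¹ - 2 * s ^ 2) * EE r s x) x := by
  have hx2 : HasDerivAt (fun x : ℝ => x ^ 2) (2 * x) x := by simpa using hasDerivAt_pow 2 x
  have hi : HasDerivAt (fun x : ℝ => (x ^ 2)⁻¹) (-(2 * x) / (x ^ 2) ^ 2) x :=
    hx2.inv (by positivity)
  have h1 := ((hi.const_mul (r ^ 2 / 4)).neg.sub (hx2.const_mul (s ^ 2))).exp
  have h2 := (hasDerivAt_inv hx.ne').mul h1
  convert! h2 using 1
  · ext y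
    simp only [Pi.mul_apply, EE, Pi.sub_apply, Pi.neg_apply]
    congr 3
    rw [div_mul_eq_div_div, div_eq_mul_inv (r^2/4)]
  · simp only [EE, Pi.sub_apply, Pi.neg_apply]
    have : r ^ 2 / 4 * (x ^ 2)⁻¹ = r ^ 2 / (4 * x ^ 2) := by field_simp
    rw [this]
    field_simp
    ring

lemma EE_le (hr : 0 < r) (x : ℝ) (hx : 0 < x) : x⁻¹ * EE r s x ≤ 4 / r ^ 2 * x := by
  have h1 : EE r s x ≤ Real.exp (-(r ^ 2 / (4 * x ^ 2))) := by
    apply Real.exp_le_exp.2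
    nlinarith [mul_nonneg (sq_nonneg s) (sq_nonneg x)]
  have h2 : Real.exp (-(r ^ 2 / (4 * x ^ 2))) ≤ (r ^ 2 / (4 * x ^ 2))⁻¹ := by
    rw [Real.exp_neg]
    apply inv_anti₀ (by positivity)
    linarith [Real.add_one_le_exp (r ^ 2 / (4 * x ^ 2))]
  calc x⁻¹ * EE r s x ≤ x⁻¹ * (r ^ 2 / (4 * x ^ 2))⁻¹ := by
        gcongr; exact h1.trans h2
    _ = 4 / r ^ 2 * x := by field_simp

lemma EE_zero (hr : 0 < r) : Tendsto (fun x : ℝ => x⁻¹ * EE r s x) (𝓝[>] 0) (𝓝 0) := by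
  have h1 : Tendsto (fun x : ℝ => 4 / r ^ 2 * x) (𝓝[>] 0) (𝓝 0) := by
    have : Tendsto (fun x : ℝ => 4 / r ^ 2 * x) (𝓝 0) (𝓝 (4 / r ^ 2 * 0)) :=
      Continuous.tendsto (by fun_prop) 0
    rw [mul_zero] at this
    exact this.mono_left nhdsWithin_le_nhds
  refine tendsto_of_tendsto_of_tendsto_of_le_of_le' tendsto_const_nhds h1 ?_ ?_
  · filter_upwards [self_mem_nhdsWithin] with x hx
    have : (0:ℝ) < x := hx
    have := EE_pos r s x
    positivity
  · filter_upwards [self_mem_nhdsWithin] with x hx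
    exact EE_le hr x hx

lemma EE_top : Tendsto (fun x : ℝ => x⁻¹ * EE r s x) atTop (𝓝 0) := by
  refine tendsto_of_tendsto_of_tendsto_of_le_of_le' tendsto_const_nhds tendsto_inv_atTop_zero ?_ ?_
  · filter_upwards [Ioi_mem_atTop (0:ℝ)] with x hx
    have : (0:ℝ) < x := hx
    have := EE_pos r s x
    positivity
  · filter_upwards [Ioi_mem_atTop (0:ℝ)] with x hx
    have h0 : (0:ℝ) < x := hx
    have : EE r s x ≤ 1 := by
      apply Real.exp_le_one_iff.2
      have : 0 ≤ r ^ 2 / (4 * x ^ 2) := by positivity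
      nlinarith [mul_nonneg (sq_nonneg s) (sq_nonneg x)]
    have h1 : 0 < x⁻¹ := by positivity
    nlinarith

lemma I2 (hr : 0 < r) (hs : 0 < s) :
    IntegrableOn (fun x => (x ^ 2)⁻¹ * EE r s x) (Ioi 0) ∧
    ∫ x in Ioi (0:ℝ), (x ^ 2)⁻¹ * EE r s x = Real.sqrt Real.pi * Real.exp (-(s * r)) / r := by
  have hd : ∀ x ∈ Ioi (0:ℝ), HasDerivAt (fun x : ℝ => r⁻¹ *
      (Real.exp (-(s * r)) * erfG (s * x - r / (2 * x)) -
        Real.exp (s * r) * erfG (s * x + r / (2 * x)))) ((x ^ 2)⁻¹ * EE r s x) x := by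
    intro x hx
    have hx : 0 < x := hx
    have h := ((deriv_minus (r := r) (s := s) x hx).sub (deriv_plus (r := r) (s := s) x hx)).const_mul r⁻¹
    convert! h using 1
    field_simp; ring
  have h := ftc_Ioi hd (fun x hx => by
      have := EE_pos r s x
      have : (0:ℝ) < x := hx
      positivity)
    ((((erfG_bot.comp (lim_minus_zero hr)).const_mul _).sub
      ((erfG_top.comp (lim_plus_zero hr)).const_mul _)).const_mul _)
    ((((erfG_top.comp (lim_minus_top hs)).const_mul _).sub
      ((erfG_top.comp (lim_plus_top hs)).const_mul _)).const_mul _)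
  refine ⟨h.1, h.2.trans ?_⟩
  field_simp; ring

lemma I4 (hr : 0 < r) (hs : 0 < s) :
    IntegrableOn (fun x => (x ^ 4)⁻¹ * EE r s x) (Ioi 0) ∧
    ∫ x in Ioi (0:ℝ), (x ^ 4)⁻¹ * EE r s x =
      2 * Real.sqrt Real.pi * (1 + s * r) * Real.exp (-(s * r)) / r ^ 3 := by
  have hd : ∀ x ∈ Ioi (0:ℝ), HasDerivAt (fun x : ℝ => 2 / r ^ 2 * (x⁻¹ * EE r s x +
      ((1 / r + s) * (Real.exp (-(s * r)) * erfG (s * x - r / (2 * x))) +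
        (s - 1 / r) * (Real.exp (s * r) * erfG (s * x + r / (2 * x))))))
        ((x ^ 4)⁻¹ * EE r s x) x := by
    intro x hx
    have hx : 0 < x := hx
    have h := ((deriv_EE (r := r) (s := s) x hx).add
      (((deriv_minus (r := r) (s := s) x hx).const_mul (1 / r + s)).add
      ((deriv_plus (r := r) (s := s) x hx).const_mul (s - 1 / r)))).const_mul (2 / r ^ 2)
    convert! h using 1
    field_simp; ring
  have h := ftc_Ioi hd (fun x hx => by
      have := EE_pos r s x
      have : (0:ℝ) < x := hx
      positivity)
    (((EE_zero hr).add ((((erfG_bot.comp (lim_minus_zero hr)).const_mul _).const_mul _).add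
      (((erfG_top.comp (lim_plus_zero hr)).const_mul _).const_mul _))).const_mul _)
    ((EE_top.add ((((erfG_top.comp (lim_minus_top hs)).const_mul _).const_mul _).add
      (((erfG_top.comp (lim_plus_top hs)).const_mul _).const_mul _))).const_mul _)
  refine ⟨h.1, h.2.trans ?_⟩
  field_simp; ring
end

/-! ### Integrability of the Fourier transform -/

lemma bigPsi_integrable (ψ : SchwartzMap (ℝ × ℝ) ℂ) : Integrable (BigPsi ψ) := by
  let e : WithLp 2 (ℝ × ℝ) ≃L[ℝ] (ℝ × ℝ) := WithLp.prodContinuousLinearEquiv 2 ℝ ℝ ℝ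
  let φ : SchwartzMap (WithLp 2 (ℝ × ℝ)) ℂ := SchwartzMap.compCLMOfContinuousLinearEquiv ℂ e ψ
  have h1 : Integrable (FourierTransform.fourier φ : SchwartzMap (WithLp 2 (ℝ × ℝ)) ℂ) :=
    SchwartzMap.integrable _
  have h2 := (WithLp.volume_preserving_toLp ℝ ℝ).integrable_comp h1.aestronglyMeasurable |>.2 h1
  have h3 := h2.comp_smul (R := (2 * Real.pi)⁻¹) (by positivity)
  refine h3.congr (Eventually.of_forall fun x => ?_)
  simp only [Function.comp]
  rw [SchwartzMap.fourier_coe, Real.fourier_eq']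
  rw [← (WithLp.volume_preserving_toLp ℝ ℝ).integral_comp
    (MeasurableEquiv.toLp 2 (ℝ × ℝ)).measurableEmbedding]
  unfold BigPsi
  refine integral_congr_ae (Eventually.of_forall fun v => ?_)
  simp only [φ, e, SchwartzMap.compCLMOfContinuousLinearEquiv_apply, smul_eq_mul]
  rw [mul_comm]
  congr 2
  have : (2 * Real.pi : ℂ) ≠ 0 := by simp [Real.pi_ne_zero]
  have h2 : inner ℝ (WithLp.toLp 2 v) (WithLp.toLp 2 ((2 * Real.pi)⁻¹ • x)) =
      (2 * Real.pi)⁻¹ * (x.1 * v.1 + x.2 * v.2) := by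
    simp [WithLp.prod_inner_apply]; ring
  rw [h2]
  push_cast
  field_simp

/-! ### Gaussian Fourier transform -/

/-- Planar heat kernel at time `x²`. -/
noncomputable def pk (x : ℝ) (z : ℝ × ℝ) : ℝ :=
  (4 * Real.pi * x ^ 2)⁻¹ * Real.exp (-((z.1 ^ 2 + z.2 ^ 2) / (4 * x ^ 2)))

lemma pk_split (x : ℝ) (z : ℝ × ℝ) :
    pk x z = (4 * Real.pi * x ^ 2)⁻¹ * (Real.exp (-(4 * x ^ 2)⁻¹ * z.1 ^ 2) *
      Real.exp (-(4 * x ^ 2)⁻¹ * z.2 ^ 2)) := by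
  rw [← Real.exp_add, pk]; congr 2; ring

lemma pk_integrable (x : ℝ) (hx : 0 < x) : Integrable (pk x) := by
  have h := integrable_exp_neg_mul_sq (b := (4 * x ^ 2)⁻¹) (by positivity)
  have h2 := (h.mul_prod h).const_mul (4 * Real.pi * x ^ 2)⁻¹
  refine h2.congr (Eventually.of_forall fun z => ?_)
  exact (pk_split x z).symm

lemma pk_fourier (x : ℝ) (hx : 0 < x) (v : ℝ × ℝ) :
    ∫ z : ℝ × ℝ, (pk x z : ℂ) * Complex.exp (-Complex.I * ((z.1 * v.1 + z.2 * v.2 : ℝ) : ℂ)) =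
      (Real.exp (-(x ^ 2 * (v.1 ^ 2 + v.2 ^ 2))) : ℂ) := by
  have hx' : (x : ℂ) ≠ 0 := by exact_mod_cast hx.ne'
  have hpi : (Real.pi : ℂ) ≠ 0 := by exact_mod_cast Real.pi_ne_zero
  set β : ℂ := (((4 * x ^ 2)⁻¹ : ℝ) : ℂ) with hβ
  have hre : 0 < β.re := by rw [hβ, Complex.ofReal_re]; positivity
  have hβ0 : β ≠ 0 := by rw [hβ]; simp [hx.ne']
  have h1 := fourierIntegral_gaussian hre (-(v.1:ℂ))
  have h2 := fourierIntegral_gaussian hre (-(v.2:ℂ))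
  have h3 := integral_prod_mul (μ := (volume : Measure ℝ)) (ν := (volume : Measure ℝ))
    (fun t : ℝ => Complex.exp (Complex.I * (-(v.1:ℂ)) * t) * Complex.exp (-β * t ^ 2))
    (fun t : ℝ => Complex.exp (Complex.I * (-(v.2:ℂ)) * t) * Complex.exp (-β * t ^ 2))
  rw [h1, h2] at h3
  have h4 : ∀ z : ℝ × ℝ, (pk x z : ℂ) *
      Complex.exp (-Complex.I * ((z.1 * v.1 + z.2 * v.2 : ℝ) : ℂ)) =
      ((4 * Real.pi * x ^ 2)⁻¹ : ℂ) *
      ((Complex.exp (Complex.I * (-(v.1:ℂ)) * z.1) * Complex.exp (-β * z.1 ^ 2)) *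
      (Complex.exp (Complex.I * (-(v.2:ℂ)) * z.2) * Complex.exp (-β * z.2 ^ 2))) := by
    intro z
    rw [pk, hβ]
    push_cast
    rw [mul_assoc, ← Complex.exp_add, ← Complex.exp_add, ← Complex.exp_add, ← Complex.exp_add]
    congr 2
    field_simp
    ring
  simp_rw [h4]
  rw [integral_const_mul, Measure.volume_eq_prod, h3]
  have h5 : (Real.pi / β) ^ (1 / 2 : ℂ) * (Real.pi / β) ^ (1 / 2 : ℂ) = Real.pi / β := by
    rw [← Complex.cpow_add _ _ (div_ne_zero hpi hβ0)]
    norm_num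
  have h6 : Real.pi / β = 4 * Real.pi * x ^ 2 := by
    rw [hβ]; push_cast; field_simp
  calc _ = ((4 * Real.pi * x ^ 2)⁻¹ : ℂ) * (((Real.pi / β) ^ (1 / 2 : ℂ) *
        (Real.pi / β) ^ (1 / 2 : ℂ)) * (Complex.exp (-(-(v.1:ℂ)) ^ 2 / (4 * β)) *
        Complex.exp (-(-(v.2:ℂ)) ^ 2 / (4 * β)))) := by ring
    _ = _ := by
      rw [h5, h6, ← mul_assoc, inv_mul_cancel₀ (by simp [hpi, hx']), one_mul, ← Complex.exp_add]
      push_cast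
      congr 1
      rw [hβ]; push_cast; field_simp; ring

lemma pk_parseval (ψ : SchwartzMap (ℝ × ℝ) ℂ) (x : ℝ) (hx : 0 < x) :
    ∫ z : ℝ × ℝ, (pk x z : ℂ) * BigPsi ψ z =
      ∫ v : ℝ × ℝ, (Real.exp (-(x ^ 2 * (v.1 ^ 2 + v.2 ^ 2))) : ℂ) * ψ v := by
  have hψ : Integrable (ψ : ℝ × ℝ → ℂ) := ψ.integrable
  have hp : Integrable (fun z => (pk x z : ℂ)) := (pk_integrable x hx).ofReal
  have hprod := hp.mul_prod hψ
  have hi : Integrable (fun q : (ℝ × ℝ) × (ℝ × ℝ) =>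
      Complex.exp (-Complex.I * ((q.1.1 * q.2.1 + q.1.2 * q.2.2 : ℝ) : ℂ)) *
        ((pk x q.1 : ℂ) * ψ q.2)) := by
    refine hprod.bdd_mul (c := 1) (Continuous.aestronglyMeasurable (by fun_prop)) ?_
    refine Eventually.of_forall fun q => ?_
    rw [Complex.norm_exp]
    simp
  have hsw := integral_integral_swap (f := fun z v : ℝ × ℝ =>
    Complex.exp (-Complex.I * ((z.1 * v.1 + z.2 * v.2 : ℝ) : ℂ)) * ((pk x z : ℂ) * ψ v)) hi
  calc _ = ∫ z : ℝ × ℝ, ∫ v : ℝ × ℝ,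
      Complex.exp (-Complex.I * ((z.1 * v.1 + z.2 * v.2 : ℝ) : ℂ)) * ((pk x z : ℂ) * ψ v) := by
        congr 1; ext z
        rw [BigPsi, ← integral_const_mul]
        congr 1; ext v; ring
    _ = _ := hsw
    _ = _ := by
        congr 1; ext v
        rw [← pk_fourier x hx v, ← integral_mul_const]
        congr 1; ext z; ring

/-! ### Subordination -/

lemma sub_fubini (w : ℝ → ℝ × ℝ → ℝ) (hw : Measurable (Function.uncurry w))
    (hpos : ∀ x ∈ Ioi (0:ℝ), ∀ z, 0 ≤ w x z) (K : ℝ × ℝ → ℝ)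
    (hI : ∀ z, IntegrableOn (fun x => w x z) (Ioi 0))
    (hK : ∀ z, ∫ x in Ioi (0:ℝ), w x z = K z) (C : ℝ) (hC : ∀ z, K z ≤ C)
    (f : ℝ × ℝ → ℂ) (hf : Integrable f) :
    ∫ z, (K z : ℂ) * f z = ∫ x in Ioi (0:ℝ), ∫ z, (w x z : ℂ) * f z := by
  have hK0 : ∀ z, 0 ≤ K z := fun z => by
    rw [← hK z]
    exact setIntegral_nonneg measurableSet_Ioi fun x hx => hpos x hx z
  have hmK : AEStronglyMeasurable K volume := by
    have : StronglyMeasurable (fun z => ∫ x in Ioi (0:ℝ), w x z) :=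
      StronglyMeasurable.integral_prod_right (f := fun z x => w x z)
        (hw.comp measurable_swap).stronglyMeasurable
    have h2 : K = fun z => ∫ x in Ioi (0:ℝ), w x z := by ext z; rw [hK]
    rw [h2]; exact this.aestronglyMeasurable
  have hm : AEStronglyMeasurable (fun q : (ℝ × ℝ) × ℝ => (w q.2 q.1 : ℂ) * f q.1)
      (volume.prod (volume.restrict (Ioi 0))) := by
    refine AEStronglyMeasurable.mul ?_ hf.aestronglyMeasurable.comp_fst
    exact (Complex.measurable_ofReal.comp (hw.comp measurable_swap)).aestronglyMeasurable
  have hint : Integrable (fun q : (ℝ × ℝ) × ℝ => (w q.2 q.1 : ℂ) * f q.1)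
      (volume.prod (volume.restrict (Ioi 0))) := by
    rw [integrable_prod_iff hm]
    refine ⟨Eventually.of_forall fun z => ((hI z).ofReal (𝕜 := ℂ)).mul_const (f z), ?_⟩
    have h2 : (fun z => ∫ x in Ioi (0:ℝ), ‖(w x z : ℂ) * f z‖) = fun z => K z * ‖f z‖ := by
      ext z
      rw [← hK z, ← integral_mul_const]
      refine setIntegral_congr_fun measurableSet_Ioi fun x hx => ?_
      simp [abs_of_nonneg (hpos x hx z)]
    simp only
    rw [h2]
    refine hf.norm.bdd_mul (c := C) hmK (Eventually.of_forall fun z => ?_)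
    rw [Real.norm_of_nonneg (hK0 z)]; exact hC z
  rw [← integral_integral_swap hint]
  congr 1; ext z
  rw [integral_mul_const, ← hK z]
  congr 1
  exact integral_ofReal.symm

lemma EE_meas (r s : ℝ) : Measurable (EE r s) := by
  unfold EE; fun_prop

lemma real_case (ψ : SchwartzMap (ℝ × ℝ) ℂ) (h s : ℝ) (hh : 0 < h) (hs : 0 < s) :
    ∫ z : ℝ × ℝ, ((h * (1 + s * Real.sqrt (z.1 ^ 2 + z.2 ^ 2 + h ^ 2)) *
      Real.exp (-(s * Real.sqrt (z.1 ^ 2 + z.2 ^ 2 + h ^ 2))) /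
      (2 * Real.pi * Real.sqrt (z.1 ^ 2 + z.2 ^ 2 + h ^ 2) ^ 3) : ℝ) : ℂ) * BigPsi ψ z =
    ∫ v : ℝ × ℝ, (Real.exp (-(Real.sqrt (v.1 ^ 2 + v.2 ^ 2 + s ^ 2) * h)) : ℂ) * ψ v := by
  have hpi : 0 < Real.pi := Real.pi_pos
  have hsp : 0 < Real.sqrt Real.pi := Real.sqrt_pos.2 hpi
  have hmw : Measurable (fun q : ℝ × (ℝ × ℝ) => h / Real.sqrt Real.pi * ((q.1 ^ 2)⁻¹ * EE h s q.1)) := by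
    have : Measurable (fun q : ℝ × (ℝ × ℝ) => EE h s q.1) := (EE_meas h s).comp measurable_fst
    fun_prop
  have key1 : ∀ (z : ℝ × ℝ), ∀ x ∈ Ioi (0:ℝ),
      h / Real.sqrt Real.pi * ((x ^ 2)⁻¹ * EE h s x) * pk x z =
      h / Real.sqrt Real.pi / (4 * Real.pi) * ((x ^ 4)⁻¹ *
        EE (Real.sqrt (z.1 ^ 2 + z.2 ^ 2 + h ^ 2)) s x) := by
    intro z x hx
    have hx : 0 < x := hx
    have : EE (Real.sqrt (z.1 ^ 2 + z.2 ^ 2 + h ^ 2)) s x =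
      EE h s x * Real.exp (-((z.1 ^ 2 + z.2 ^ 2) / (4 * x ^ 2))) := by
      rw [EE, EE, Real.sq_sqrt (by positivity), ← Real.exp_add]
      congr 1; ring
    rw [this, pk]
    field_simp
  have key2 : ∀ (v : ℝ × ℝ), ∀ x ∈ Ioi (0:ℝ),
      h / Real.sqrt Real.pi * ((x ^ 2)⁻¹ * EE h s x) * Real.exp (-(x ^ 2 * (v.1 ^ 2 + v.2 ^ 2))) =
      h / Real.sqrt Real.pi * ((x ^ 2)⁻¹ *
        EE h (Real.sqrt (v.1 ^ 2 + v.2 ^ 2 + s ^ 2)) x) := by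
    intro v x hx
    have : EE h (Real.sqrt (v.1 ^ 2 + v.2 ^ 2 + s ^ 2)) x =
      EE h s x * Real.exp (-(x ^ 2 * (v.1 ^ 2 + v.2 ^ 2))) := by
      rw [EE, EE, Real.sq_sqrt (by positivity), ← Real.exp_add]
      congr 1; ring
    rw [this]; ring
  have hr : ∀ z : ℝ × ℝ, 0 < Real.sqrt (z.1 ^ 2 + z.2 ^ 2 + h ^ 2) := fun z =>
    Real.sqrt_pos.2 (by positivity)
  have hσ : ∀ z : ℝ × ℝ, 0 < Real.sqrt (z.1 ^ 2 + z.2 ^ 2 + s ^ 2) := fun z =>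
    Real.sqrt_pos.2 (by positivity)
  have e1 := sub_fubini (fun x z => h / Real.sqrt Real.pi * ((x ^ 2)⁻¹ * EE h s x) * pk x z)
    (by
      have : Measurable (fun q : ℝ × (ℝ × ℝ) => pk q.1 q.2) := by unfold pk; fun_prop
      exact hmw.mul this)
    (fun x hx z => by
      have hx : 0 < x := hx
      have := EE_pos h s x
      unfold pk; positivity)
    (fun z => h * (1 + s * Real.sqrt (z.1 ^ 2 + z.2 ^ 2 + h ^ 2)) *
      Real.exp (-(s * Real.sqrt (z.1 ^ 2 + z.2 ^ 2 + h ^ 2))) /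
      (2 * Real.pi * Real.sqrt (z.1 ^ 2 + z.2 ^ 2 + h ^ 2) ^ 3))
    (fun z => by
      refine IntegrableOn.congr_fun ?_ (fun x hx => (key1 z x hx).symm) measurableSet_Ioi
      exact (I4 (hr z) hs).1.const_mul _)
    (fun z => by
      rw [setIntegral_congr_fun measurableSet_Ioi (key1 z), integral_const_mul, (I4 (hr z) hs).2]
      have := hr z
      field_simp
      ring)
    (h / (2 * Real.pi * h ^ 3))
    (fun z => by
      have hrz := hr z
      have hle : h ≤ Real.sqrt (z.1 ^ 2 + z.2 ^ 2 + h ^ 2) :=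
        Real.le_sqrt_of_sq_le (by nlinarith [sq_nonneg z.1, sq_nonneg z.2])
      set r := Real.sqrt (z.1 ^ 2 + z.2 ^ 2 + h ^ 2)
      have h1 : (1 + s * r) * Real.exp (-(s * r)) ≤ 1 := by
        rw [Real.exp_neg, ← div_eq_mul_inv, div_le_one (Real.exp_pos _)]
        linarith [Real.add_one_le_exp (s * r)]
      rw [mul_assoc]
      calc h * ((1 + s * r) * Real.exp (-(s * r))) / (2 * Real.pi * r ^ 3)
          ≤ h * 1 / (2 * Real.pi * h ^ 3) := by gcongr
        _ = _ := by rw [mul_one])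
    (BigPsi ψ) (bigPsi_integrable ψ)
  have e2 := sub_fubini (fun x v => h / Real.sqrt Real.pi * ((x ^ 2)⁻¹ * EE h s x) *
      Real.exp (-(x ^ 2 * (v.1 ^ 2 + v.2 ^ 2))))
    (by
      have : Measurable (fun q : ℝ × (ℝ × ℝ) =>
        Real.exp (-(q.1 ^ 2 * (q.2.1 ^ 2 + q.2.2 ^ 2)))) := by fun_prop
      exact hmw.mul this)
    (fun x hx z => by
      have hx : 0 < x := hx
      have := EE_pos h s x
      positivity)
    (fun v => Real.exp (-(Real.sqrt (v.1 ^ 2 + v.2 ^ 2 + s ^ 2) * h)))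
    (fun z => by
      refine IntegrableOn.congr_fun ?_ (fun x hx => (key2 z x hx).symm) measurableSet_Ioi
      exact (I2 hh (hσ z)).1.const_mul _)
    (fun z => by
      rw [setIntegral_congr_fun measurableSet_Ioi (key2 z), integral_const_mul, (I2 hh (hσ z)).2]
      field_simp)
    1
    (fun z => Real.exp_le_one_iff.2 (by have := hσ z; nlinarith))
    ψ ψ.integrable
  rw [e1, e2]
  refine setIntegral_congr_fun measurableSet_Ioi fun x hx => ?_
  have hx : 0 < x := hx
  have hc := congrArg (fun t : ℂ => ((h / Real.sqrt Real.pi * ((x ^ 2)⁻¹ * EE h s x) : ℝ) : ℂ) * t)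
    (pk_parseval ψ x hx)
  simp only [← integral_const_mul, ← mul_assoc, ← Complex.ofReal_mul] at hc
  simp only [mul_assoc] at hc ⊢
  exact hc

/-! ### Analytic continuation in the wavenumber -/

/-- The kernel with complex parameter `s` (`s = -ik` for the Helmholtz case). -/
noncomputable def KC (h : ℝ) (s : ℂ) (z : ℝ × ℝ) : ℂ :=
  (h : ℂ) * (1 + s * (Real.sqrt (z.1 ^ 2 + z.2 ^ 2 + h ^ 2) : ℂ)) *
    Complex.exp (-(s * (Real.sqrt (z.1 ^ 2 + z.2 ^ 2 + h ^ 2) : ℂ))) /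
    (2 * (Real.pi : ℂ) * (Real.sqrt (z.1 ^ 2 + z.2 ^ 2 + h ^ 2) : ℂ) ^ 3)

/-- The symbol with complex parameter `s`. -/
noncomputable def SC (h : ℝ) (s : ℂ) (v : ℝ × ℝ) : ℂ :=
  Complex.exp (-((((v.1 ^ 2 + v.2 ^ 2 : ℝ) : ℂ) + s ^ 2) ^ (1 / 2 : ℂ) * h))

lemma KC_meas (h : ℝ) (s : ℂ) : Measurable (KC h s) := by unfold KC; fun_prop

lemma SC_meas (h : ℝ) (s : ℂ) : Measurable (SC h s) := by unfold SC; fun_prop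

lemma le_rr {h : ℝ} (hh : 0 < h) (z : ℝ × ℝ) : h ≤ Real.sqrt (z.1 ^ 2 + z.2 ^ 2 + h ^ 2) :=
  Real.le_sqrt_of_sq_le (by nlinarith [sq_nonneg z.1, sq_nonneg z.2])

lemma norm_exp_le {s : ℂ} (hs : 0 ≤ s.re) {r : ℝ} (hr : 0 ≤ r) :
    ‖Complex.exp (-(s * (r : ℂ)))‖ ≤ 1 := by
  rw [Complex.norm_exp]
  apply Real.exp_le_one_iff.2
  simp
  positivity

lemma KC_bound {h : ℝ} (hh : 0 < h) {s : ℂ} (hs : 0 ≤ s.re) (z : ℝ × ℝ) :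
    ‖KC h s z‖ ≤ h / (2 * Real.pi * h ^ 3) + h * ‖s‖ / (2 * Real.pi * h ^ 2) := by
  have hle := le_rr hh z
  unfold KC
  set r := Real.sqrt (z.1 ^ 2 + z.2 ^ 2 + h ^ 2)
  have hr : 0 < r := hh.trans_le hle
  have h1 := norm_exp_le hs hr.le
  have h2 : ‖1 + s * (r : ℂ)‖ ≤ 1 + ‖s‖ * r := by
    refine (norm_add_le _ _).trans ?_
    simp [abs_of_pos hr]
  have hpi := Real.pi_pos
  rw [norm_div, norm_mul, norm_mul, norm_mul, norm_mul, norm_pow]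
  simp only [Complex.norm_real, Real.norm_of_nonneg hh.le, Real.norm_of_nonneg hr.le,
    Real.norm_of_nonneg hpi.le, Complex.norm_ofNat]
  calc h * ‖1 + s * (r:ℂ)‖ * ‖Complex.exp (-(s * (r:ℂ)))‖ / (2 * Real.pi * r ^ 3)
      ≤ h * (1 + ‖s‖ * r) * 1 / (2 * Real.pi * r ^ 3) := by gcongr
    _ = h / (2 * Real.pi * r ^ 3) + h * ‖s‖ / (2 * Real.pi * r ^ 2) := by
        field_simp
    _ ≤ _ := by gcongr

lemma re_sqrt_nonneg (w : ℂ) : 0 ≤ (w ^ (1 / 2 : ℂ)).re := by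
  by_cases hw : w = 0
  · subst hw; simp
  rw [Complex.cpow_def_of_ne_zero hw, Complex.exp_re]
  refine mul_nonneg (Real.exp_pos _).le ?_
  have him : (Complex.log w * (1 / 2)).im = w.arg / 2 := by
    have : Complex.log w * (1 / 2 : ℂ) = Complex.log w * ((1 / 2 : ℝ) : ℂ) := by push_cast; rfl
    rw [this, Complex.im_mul_ofReal, Complex.log_im]; ring
  rw [him]
  apply Real.cos_nonneg_of_neg_pi_div_two_le_of_le
  · linarith [Complex.neg_pi_lt_arg w]
  · linarith [Complex.arg_le_pi w]

lemma SC_bound {h : ℝ} (hh : 0 < h) (s : ℂ) (v : ℝ × ℝ) : ‖SC h s v‖ ≤ 1 :=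
  norm_exp_le (re_sqrt_nonneg _) hh.le

lemma mem_slit {a : ℝ} (ha : 0 ≤ a) {s : ℂ} (hs : 0 < s.re) : (a : ℂ) + s ^ 2 ∈ Complex.slitPlane := by
  rw [Complex.mem_slitPlane_iff]
  by_cases him : s.im = 0
  · left
    simp [sq, him]; positivity
  · right
    simp [sq]
    intro h
    have : s.re * s.im = 0 := by linarith
    rcases mul_eq_zero.1 this with h | h
    · exact hs.ne' h
    · exact him h

lemma norm_ge {a : ℝ} (ha : 0 ≤ a) (s : ℂ) : s.re ^ 2 ≤ ‖(a : ℂ) + s ^ 2‖ := by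
  rw [Complex.norm_def]
  apply Real.le_sqrt_of_sq_le
  rw [Complex.normSq_apply]
  simp [sq]
  nlinarith [sq_nonneg (a - s.im ^ 2), mul_nonneg (sq_nonneg s.re) ha,
    mul_nonneg (sq_nonneg s.re) (sq_nonneg s.im)]

lemma KC_deriv {h : ℝ} (hh : 0 < h) (z : ℝ × ℝ) (s : ℂ) :
    HasDerivAt (fun s => KC h s z) (-(h * s * Complex.exp (-(s *
      (Real.sqrt (z.1 ^ 2 + z.2 ^ 2 + h ^ 2) : ℂ))) /
      (2 * (Real.pi : ℂ) * (Real.sqrt (z.1 ^ 2 + z.2 ^ 2 + h ^ 2) : ℂ)))) s := by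
  have hle := le_rr hh z
  unfold KC
  set r := Real.sqrt (z.1 ^ 2 + z.2 ^ 2 + h ^ 2)
  have hr : (r : ℂ) ≠ 0 := by exact_mod_cast (hh.trans_le hle).ne'
  have hpi : (Real.pi : ℂ) ≠ 0 := by exact_mod_cast Real.pi_ne_zero
  have h1 : HasDerivAt (fun s : ℂ => s * (r : ℂ)) r s := by
    simpa using (hasDerivAt_id s).mul_const (r : ℂ)
  have h2 := (((h1.const_add 1).const_mul (h : ℂ)).mul (h1.neg.cexp)).div_const
    (2 * (Real.pi : ℂ) * (r : ℂ) ^ 3)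
  convert! h2 using 1
  simp only [Pi.neg_apply]
  field_simp
  ring

lemma SC_deriv (h : ℝ) (v : ℝ × ℝ) (s : ℂ) (hs : 0 < s.re) :
    HasDerivAt (fun s => SC h s v) (-(SC h s v * h * s *
      (((v.1 ^ 2 + v.2 ^ 2 : ℝ) : ℂ) + s ^ 2) ^ (-(1 / 2) : ℂ))) s := by
  have h1 : HasDerivAt (fun s : ℂ => ((v.1 ^ 2 + v.2 ^ 2 : ℝ) : ℂ) + s ^ 2) (2 * s) s := by
    simpa using (hasDerivAt_pow 2 s).const_add ((v.1 ^ 2 + v.2 ^ 2 : ℝ) : ℂ)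
  have h2 := ((h1.cpow_const (c := (1 / 2 : ℂ)) (mem_slit (by positivity) hs)).mul_const
    (h : ℂ)).neg.cexp
  convert! h2 using 1
  have : (1 / 2 : ℂ) - 1 = -(1 / 2) := by norm_num
  rw [this]
  simp only [SC, Pi.neg_apply]
  ring

lemma diff_param (F F' : ℂ → ℝ × ℝ → ℂ) (f : ℝ × ℝ → ℂ) (hf : Integrable f)
    (hm : ∀ s, Measurable (F s)) (hm' : ∀ s, Measurable (F' s))
    (M : ℂ → ℝ) (hM : ∀ s : ℂ, 0 < s.re → ∀ z, ‖F s z‖ ≤ M s)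
    (B : ℝ → ℝ → ℝ) (hB : ∀ δ R : ℝ, 0 < δ → ∀ s : ℂ, δ < s.re → ‖s‖ < R → ∀ z, ‖F' s z‖ ≤ B δ R)
    (hd : ∀ s : ℂ, 0 < s.re → ∀ z, HasDerivAt (fun s => F s z) (F' s z) s) :
    DifferentiableOn ℂ (fun s => ∫ z, F s z * f z) {s : ℂ | 0 < s.re} := by
  intro s₀ hs₀
  have hs₀ : 0 < s₀.re := hs₀
  refine DifferentiableAt.differentiableWithinAt ?_
  have hnhds : {s : ℂ | s₀.re / 2 < s.re} ∩ {s : ℂ | ‖s‖ < ‖s₀‖ + 1} ∈ 𝓝 s₀ := by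
    refine IsOpen.mem_nhds (IsOpen.inter ?_ ?_) ⟨?_, ?_⟩
    · exact isOpen_lt continuous_const Complex.continuous_re
    · exact isOpen_lt continuous_norm continuous_const
    · show s₀.re / 2 < s₀.re
      linarith
    · show ‖s₀‖ < ‖s₀‖ + 1
      linarith
  refine (hasDerivAt_integral_of_dominated_loc_of_deriv_le (F := fun s z => F s z * f z)
    (F' := fun s z => F' s z * f z)
    (bound := fun z => B (s₀.re / 2) (‖s₀‖ + 1) * ‖f z‖) hnhds ?_ ?_ ?_ ?_ ?_ ?_).2.differentiableAt
  · exact Eventually.of_forall fun s => (hm s).aestronglyMeasurable.mul hf.aestronglyMeasurable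
  · exact hf.bdd_mul (hm s₀).aestronglyMeasurable (Eventually.of_forall (hM s₀ hs₀))
  · exact (hm' s₀).aestronglyMeasurable.mul hf.aestronglyMeasurable
  · refine Eventually.of_forall fun z s hs => ?_
    rw [norm_mul]
    exact mul_le_mul_of_nonneg_right (hB _ _ (half_pos hs₀) s hs.1 hs.2 z) (norm_nonneg _)
  · exact hf.norm.const_mul _
  · refine Eventually.of_forall fun z s hs => (hd s ?_ z).mul_const _
    exact (half_pos hs₀).trans hs.1

lemma KC_diff (ψ : SchwartzMap (ℝ × ℝ) ℂ) {h : ℝ} (hh : 0 < h) :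
    DifferentiableOn ℂ (fun s => ∫ z, KC h s z * BigPsi ψ z) {s : ℂ | 0 < s.re} := by
  refine diff_param (KC h) _ _ (bigPsi_integrable ψ) (KC_meas h) ?_ _
    (fun s hs z => KC_bound hh hs.le z) (fun δ R => h * R / (2 * Real.pi * h)) ?_
    (fun s _ z => KC_deriv hh z s)
  · intro s; fun_prop
  · intro δ R hδ s hs hR z
    have hle := le_rr hh z
    set r := Real.sqrt (z.1 ^ 2 + z.2 ^ 2 + h ^ 2)
    have hr : 0 < r := hh.trans_le hle
    have h1 := norm_exp_le (hδ.trans hs).le hr.le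
    have hpi := Real.pi_pos
    have hR0 : 0 ≤ R := (norm_nonneg s).trans hR.le
    rw [norm_neg, norm_div, norm_mul, norm_mul, norm_mul, norm_mul]
    simp only [Complex.norm_real, Real.norm_of_nonneg hh.le, Real.norm_of_nonneg hr.le,
      Real.norm_of_nonneg hpi.le, Complex.norm_ofNat]
    calc h * ‖s‖ * ‖Complex.exp (-(s * (r:ℂ)))‖ / (2 * Real.pi * r)
        ≤ h * R * 1 / (2 * Real.pi * h) := by gcongr
      _ = _ := by rw [mul_one]

lemma SC_diff (ψ : SchwartzMap (ℝ × ℝ) ℂ) {h : ℝ} (hh : 0 < h) :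
    DifferentiableOn ℂ (fun s => ∫ v, SC h s v * ψ v) {s : ℂ | 0 < s.re} := by
  refine diff_param (SC h) _ _ ψ.integrable (SC_meas h) ?_ (fun _ => 1)
    (fun s hs z => SC_bound hh s z) (fun δ R => 1 * h * R * δ⁻¹) ?_
    (fun s hs z => SC_deriv h z s hs)
  · intro s
    have := SC_meas h s
    fun_prop
  · intro δ R hδ s hs hR v
    have h1 := SC_bound hh s v
    have hR0 : 0 ≤ R := (norm_nonneg s).trans hR.le
    have ha : 0 ≤ v.1 ^ 2 + v.2 ^ 2 := by positivity
    have h3 : δ ^ 2 ≤ ‖((v.1 ^ 2 + v.2 ^ 2 : ℝ) : ℂ) + s ^ 2‖ :=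
      le_trans (by gcongr) (norm_ge ha s)
    have hne : ((v.1 ^ 2 + v.2 ^ 2 : ℝ) : ℂ) + s ^ 2 ≠ 0 :=
      Complex.slitPlane_ne_zero (mem_slit ha (hδ.trans hs))
    have h2 : ‖(((v.1 ^ 2 + v.2 ^ 2 : ℝ) : ℂ) + s ^ 2) ^ (-(1 / 2) : ℂ)‖ ≤ δ⁻¹ := by
      rw [Complex.norm_cpow_of_ne_zero hne]
      have e1 : (-(1 / 2) : ℂ).re = -(1/2) := by norm_num
      have e2 : (-(1 / 2) : ℂ).im = 0 := by norm_num
      rw [e1, e2, mul_zero, Real.exp_zero, div_one, Real.rpow_neg (norm_nonneg _),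
        ← Real.sqrt_eq_rpow]
      exact inv_anti₀ hδ (Real.le_sqrt_of_sq_le h3)
    rw [norm_neg, norm_mul, norm_mul, norm_mul]
    simp only [Complex.norm_real, Real.norm_of_nonneg hh.le]
    gcongr

lemma eq_real (ψ : SchwartzMap (ℝ × ℝ) ℂ) {h s : ℝ} (hh : 0 < h) (hs : 0 < s) :
    ∫ z, KC h s z * BigPsi ψ z = ∫ v, SC h s v * ψ v := by
  have h0 := real_case ψ h s hh hs
  have h1 : ∀ z, KC h s z = ((h * (1 + s * Real.sqrt (z.1 ^ 2 + z.2 ^ 2 + h ^ 2)) *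
      Real.exp (-(s * Real.sqrt (z.1 ^ 2 + z.2 ^ 2 + h ^ 2))) /
      (2 * Real.pi * Real.sqrt (z.1 ^ 2 + z.2 ^ 2 + h ^ 2) ^ 3) : ℝ) : ℂ) := by
    intro z; unfold KC; push_cast; rfl
  have h2 : ∀ v, SC h s v = (Real.exp (-(Real.sqrt (v.1 ^ 2 + v.2 ^ 2 + s ^ 2) * h)) : ℂ) := by
    intro v
    rw [Real.sqrt_eq_rpow, SC]
    push_cast
    rw [Complex.ofReal_cpow (by positivity)]
    push_cast
    rfl
  simp_rw [h1, h2]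
  exact h0

lemma eq_half (ψ : SchwartzMap (ℝ × ℝ) ℂ) {h : ℝ} (hh : 0 < h) {s : ℂ} (hs : 0 < s.re) :
    ∫ z, KC h s z * BigPsi ψ z = ∫ v, SC h s v * ψ v := by
  have hopen : IsOpen {s : ℂ | 0 < s.re} := isOpen_lt continuous_const Complex.continuous_re
  have hA := (KC_diff ψ hh).analyticOnNhd hopen
  have hB := (SC_diff ψ hh).analyticOnNhd hopen
  refine hA.eqOn_of_preconnected_of_frequently_eq hB
    (convex_halfSpace_re_gt 0).isPreconnected (z₀ := 1) (by simp) ?_ hs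
  have ht : Tendsto (fun x : ℝ => (x : ℂ)) (𝓝[≠] 1) (𝓝[≠] 1) := by
    refine tendsto_nhdsWithin_iff.2 ⟨?_, ?_⟩
    · have : Tendsto (fun x : ℝ => (x : ℂ)) (𝓝 1) (𝓝 ((1:ℝ):ℂ)) :=
        Complex.continuous_ofReal.tendsto 1
      rw [Complex.ofReal_one] at this
      exact this.mono_left nhdsWithin_le_nhds
    · filter_upwards [self_mem_nhdsWithin] with x hx
      intro h
      apply hx
      have : (x : ℂ) = 1 := h
      exact_mod_cast this
  refine ht.frequently (Eventually.frequently ?_)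
  have : ∀ᶠ x : ℝ in 𝓝 1, 0 < x := Ioi_mem_nhds one_pos
  filter_upwards [this.filter_mono nhdsWithin_le_nhds] with x hx
  exact eq_real ψ hh hx

/-! ### Limit onto the imaginary axis -/

lemma sqrt_neg_im {w : ℂ} (hw : w.im < 0) :
    w ^ (1 / 2 : ℂ) = -Complex.I * (-w) ^ (1 / 2 : ℂ) := by
  have h0 : w ≠ 0 := by rintro rfl; simp at hw
  have hl : Complex.log (-w) = Complex.log w + Real.pi * Complex.I := by
    rw [Complex.log, Complex.log, Complex.arg_neg_eq_arg_add_pi_of_im_neg hw, norm_neg]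
    push_cast; ring
  rw [Complex.cpow_def_of_ne_zero h0, Complex.cpow_def_of_ne_zero (neg_ne_zero.2 h0), hl,
    add_mul, Complex.exp_add]
  have : (Real.pi : ℂ) * Complex.I * (1 / 2) = Real.pi / 2 * Complex.I := by ring
  rw [this, Complex.exp_pi_div_two_mul_I]
  linear_combination (Complex.exp (Complex.log w * (1 / 2))) * Complex.I_sq

lemma ofReal_half {x : ℝ} (hx : 0 ≤ x) : (x : ℂ) ^ (1 / 2 : ℂ) = (Real.sqrt x : ℂ) := by
  rw [Real.sqrt_eq_rpow, Complex.ofReal_cpow hx]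
  push_cast; rfl

lemma tendsto_s (k : ℝ) :
    Tendsto (fun ε : ℝ => (ε : ℂ) - Complex.I * k) (𝓝[>] 0) (𝓝 (-(Complex.I * k))) := by
  have : Tendsto (fun ε : ℝ => (ε : ℂ) - Complex.I * k) (𝓝 0) (𝓝 (((0:ℝ) : ℂ) - Complex.I * k)) :=
    Continuous.tendsto (by fun_prop) 0
  simp only [Complex.ofReal_zero, zero_sub] at this
  exact this.mono_left nhdsWithin_le_nhds

lemma lim_sqrt {k : ℝ} (hk : 0 < k) (v : ℝ × ℝ) :
    Tendsto (fun ε : ℝ => (((v.1 ^ 2 + v.2 ^ 2 : ℝ) : ℂ) + ((ε : ℂ) - Complex.I * k) ^ 2) ^ (1 / 2 : ℂ))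
      (𝓝[>] 0) (𝓝 (-Complex.I * kappa k v)) := by
  have h1 : Tendsto (fun ε : ℝ => ((v.1 ^ 2 + v.2 ^ 2 : ℝ) : ℂ) + ((ε : ℂ) - Complex.I * k) ^ 2)
      (𝓝[>] 0) (𝓝 ((v.1 ^ 2 + v.2 ^ 2 - k ^ 2 : ℝ) : ℂ)) := by
    have := ((tendsto_s k).pow 2).const_add ((v.1 ^ 2 + v.2 ^ 2 : ℝ) : ℂ)
    convert this using 2
    push_cast
    rw [neg_sq, mul_pow, Complex.I_sq]; ring
  unfold kappa
  split_ifs with hc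
  · have hc0 : 0 ≤ k ^ 2 - v.1 ^ 2 - v.2 ^ 2 := by linarith
    have h2 := h1.neg
    have h3 : ContinuousAt (fun w : ℂ => w ^ (1 / 2 : ℂ))
        (-((v.1 ^ 2 + v.2 ^ 2 - k ^ 2 : ℝ) : ℂ)) := by
      apply Complex.continuousAt_cpow_const_of_re_pos
      · left
        rw [← Complex.ofReal_neg, Complex.ofReal_re]; linarith
      · norm_num
    have h4 := (h3.tendsto.comp h2).const_mul (-Complex.I)
    have h5 : -((v.1 ^ 2 + v.2 ^ 2 - k ^ 2 : ℝ) : ℂ) = ((k ^ 2 - v.1 ^ 2 - v.2 ^ 2 : ℝ) : ℂ) := by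
      push_cast; ring
    rw [h5, ofReal_half hc0] at h4
    refine h4.congr' ?_
    filter_upwards [self_mem_nhdsWithin] with ε hε
    have hε : 0 < ε := hε
    rw [sqrt_neg_im]
    · rfl
    · simp [sq]
      nlinarith [mul_pos hε hk]
  · have h3 : ContinuousAt (fun w : ℂ => w ^ (1 / 2 : ℂ))
        ((v.1 ^ 2 + v.2 ^ 2 - k ^ 2 : ℝ) : ℂ) := by
      apply Complex.continuousAt_cpow_const_of_re_pos
      · left
        rw [Complex.ofReal_re]; linarith
      · norm_num
    have h4 := h3.tendsto.comp h1
    rw [ofReal_half (by linarith)] at h4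
    have h5 : ∀ x : ℂ, -Complex.I * (Complex.I * x) = x := fun x => by
      linear_combination (-x) * Complex.I_sq
    rw [h5]
    exact h4

lemma main_lim (ψ : SchwartzMap (ℝ × ℝ) ℂ) {h k : ℝ} (hh : 0 < h) (hk : 0 < k) :
    ∫ z, KC h (-(Complex.I * k)) z * BigPsi ψ z =
      ∫ v, Complex.exp (-(-Complex.I * kappa k v * h)) * ψ v := by
  have hL : Tendsto (fun ε : ℝ => ∫ z, KC h ((ε : ℂ) - Complex.I * k) z * BigPsi ψ z) (𝓝[>] 0)
      (𝓝 (∫ z, KC h (-(Complex.I * k)) z * BigPsi ψ z)) := by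
    refine tendsto_integral_filter_of_dominated_convergence
      (fun z => (h / (2 * Real.pi * h ^ 3) + h * (1 + k) / (2 * Real.pi * h ^ 2)) * ‖BigPsi ψ z‖)
      ?_ ?_ ((bigPsi_integrable ψ).norm.const_mul _) ?_
    · exact Eventually.of_forall fun ε => (KC_meas h _).aestronglyMeasurable.mul
        (bigPsi_integrable ψ).aestronglyMeasurable
    · filter_upwards [Ioo_mem_nhdsGT (one_pos : (0:ℝ) < 1)] with ε hε
      refine Eventually.of_forall fun z => ?_
      rw [norm_mul]
      refine mul_le_mul_of_nonneg_right ?_ (norm_nonneg _)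
      refine (KC_bound hh (by simp [hε.1.le]) z).trans ?_
      have : ‖(ε : ℂ) - Complex.I * k‖ ≤ 1 + k := by
        refine (norm_sub_le _ _).trans ?_
        simp [abs_of_pos hε.1, abs_of_pos hk, hε.2.le]
      have hpi := Real.pi_pos
      gcongr
    · refine Eventually.of_forall fun z => ?_
      refine Tendsto.mul_const _ ?_
      exact ((KC_deriv hh z _).continuousAt.tendsto).comp (tendsto_s k)
  have hR : Tendsto (fun ε : ℝ => ∫ v, SC h ((ε : ℂ) - Complex.I * k) v * ψ v) (𝓝[>] 0)
      (𝓝 (∫ v, Complex.exp (-(-Complex.I * kappa k v * h)) * ψ v)) := by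
    have hψ : Integrable (ψ : ℝ × ℝ → ℂ) := ψ.integrable
    refine tendsto_integral_filter_of_dominated_convergence (fun v => ‖ψ v‖) ?_ ?_ hψ.norm ?_
    · exact Eventually.of_forall fun ε => (SC_meas h _).aestronglyMeasurable.mul
        hψ.aestronglyMeasurable
    · refine Eventually.of_forall fun ε => Eventually.of_forall fun v => ?_
      rw [norm_mul]
      exact mul_le_of_le_one_left (norm_nonneg _) (SC_bound hh _ v)
    · refine Eventually.of_forall fun v => ?_
      refine Tendsto.mul_const _ ?_
      exact (Complex.continuous_exp.tendsto _).comp (((lim_sqrt hk v).mul_const (h : ℂ)).neg)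
  refine tendsto_nhds_unique hL (hR.congr' ?_)
  filter_upwards [self_mem_nhdsWithin] with ε hε
  have hε : 0 < ε := hε
  exact (eq_half ψ hh (by simpa using hε)).symm

lemma kappa_meas (k : ℝ) : Measurable (kappa k) := by
  unfold kappa
  refine Measurable.ite ?_ (by fun_prop) (by fun_prop)
  exact measurableSet_le (by fun_prop) (by fun_prop)

lemma kappa_im (k : ℝ) (v : ℝ × ℝ) : 0 ≤ (kappa k v).im := by
  unfold kappa
  split_ifs
  · simp
  · simp

lemma Kker_eq (k b : ℝ) (z : ℝ × ℝ) : Kker k b z = -KC (-b) (-(Complex.I * k)) z := by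
  unfold Kker KC
  rw [neg_sq]
  push_cast
  ring_nf

end DLK


/-- The tempered-distribution Fourier transform on ℝ² of the
double-layer kernel `K_b` equals `−e^{−iκ b}`. -/
theorem fourier_transform_of_double_layer_kernel
    (k b : ℝ) (hk : 0 < k) (hb : b < 0) (ψ : SchwartzMap (ℝ × ℝ) ℂ) :
    Integrable (fun z : ℝ × ℝ => Kker k b z * BigPsi ψ z) (volume : Measure (ℝ × ℝ)) ∧
    Integrable (fun v : ℝ × ℝ =>
      Complex.exp (-Complex.I * kappa k v * (b : ℂ)) * ψ v) (volume : Measure (ℝ × ℝ)) ∧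
    ∫ z : ℝ × ℝ, Kker k b z * BigPsi ψ z =
      -∫ v : ℝ × ℝ, Complex.exp (-Complex.I * kappa k v * (b : ℂ)) * ψ v := by
  have hh : 0 < -b := neg_pos.2 hb
  have hψ : Integrable (ψ : ℝ × ℝ → ℂ) := ψ.integrable
  refine ⟨?_, ?_, ?_⟩
  · simp_rw [DLK.Kker_eq]
    refine (DLK.bigPsi_integrable ψ).bdd_mul
      (c := (-b) / (2 * Real.pi * (-b) ^ 3) + (-b) * ‖-(Complex.I * (k:ℂ))‖ / (2 * Real.pi * (-b) ^ 2))
      (DLK.KC_meas _ _).neg.aestronglyMeasurable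
      (Filter.Eventually.of_forall fun z => ?_)
    rw [norm_neg]
    exact DLK.KC_bound hh (by simp) z
  · refine hψ.bdd_mul (c := 1) ?_ (Filter.Eventually.of_forall fun v => ?_)
    · have := DLK.kappa_meas k
      exact (show Measurable (fun v : ℝ × ℝ => Complex.exp (-Complex.I * kappa k v * (b : ℂ))) by
        fun_prop).aestronglyMeasurable
    · rw [Complex.norm_exp]
      apply Real.exp_le_one_iff.2
      have := DLK.kappa_im k v
      simp
      nlinarith
  · simp_rw [DLK.Kker_eq, neg_mul]
    rw [integral_neg]
    congr 1
    rw [DLK.main_lim ψ hh hk]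
    congr 1; ext v
    congr 2
    push_cast
    ring
end
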